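/- Let B be a pentagonal fragment of a fullerene graph F. Then: (1) if γ(B) ≥ 3, then B contains the pentagonal ring R_5 as a subgraph; (2) if γ(B) = 2, then B has a pentagon that adjoins exactly two pentagons of B, and these two pentagons are adjacent to each other. -/

import Mathlib

namespace FG

/-- A combinatorial plane (spherically embedded) graph: a finite simple graph together with
its collection of faces, each face recorded as the finset of edges of its boundary cycle.
Every face boundary is a cycle, every edge lies on exactly two faces, and Euler's formula
holds (edges are counted via the face incidences). -/
structure PlaneGraph (V : Type) [Fintype V] [DecidableEq V] : Type where
  graph : SimpleGraph V
  faces : Finset (Finset (Sym2 V))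
  face_edges : ∀ f ∈ faces, ∀ e ∈ f, e ∈ graph.edgeSet
  face_cycle : ∀ f ∈ faces, ∃ (v : V) (c : graph.Walk v v), c.IsCycle ∧ c.edges.toFinset = f
  edge_faces : ∀ e ∈ graph.edgeSet, (faces.filter (fun f => e ∈ f)).card = 2
  euler : 2 * (Fintype.card V + faces.card) = (∑ f ∈ faces, f.card) + 4

variable {V : Type} [Fintype V] [DecidableEq V]

/-- The vertices incident with at least one edge of an edge set. -/
def edgeVerts (E : Finset (Sym2 V)) : Finset V :=
  Finset.univ.filter fun v => ∃ e ∈ E, v ∈ e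

/-- The degree of a vertex in the subgraph spanned by an edge set. -/
def deg (E : Finset (Sym2 V)) (v : V) : ℕ := (E.filter fun e => v ∈ e).card

/-- The vertices covered by a collection of faces. -/
def facesVerts (H : Finset (Finset (Sym2 V))) : Finset V := edgeVerts (H.sup id)

/-- An edge set is a matching: non-loop edges, pairwise vertex-disjoint. -/
def IsMatching (M : Finset (Sym2 V)) : Prop :=
  (∀ e ∈ M, ¬e.IsDiag) ∧ ∀ e ∈ M, ∀ e' ∈ M, e ≠ e' → ∀ v : V, v ∈ e → v ∉ e'

/-- A fullerene graph: a cubic 3-connected plane graph with (exactly 12) pentagonal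
faces and hexagonal faces. -/
structure IsFullerene (P : PlaneGraph V) : Prop where
  cubic : ∀ v : V, (P.graph.neighborSet v).ncard = 3
  threeConnected : ∀ s : Set V, s.ncard ≤ 2 → (SimpleGraph.induce sᶜ P.graph).Connected
  faceSize : ∀ f ∈ P.faces, f.card = 5 ∨ f.card = 6
  pentTwelve : (P.faces.filter fun f => f.card = 5).card = 12

/-- A fragment of a plane graph: a nonempty set of faces (a cycle together with its
interior) whose boundary — the set of edges lying on exactly one chosen face — is a
single cycle. -/
structure Fragment (P : PlaneGraph V) : Type where
  inFaces : Finset (Finset (Sym2 V))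
  nonempty : inFaces.Nonempty
  subFaces : inFaces ⊆ P.faces
  boundary_cycle : ∃ (v : V) (c : P.graph.Walk v v), c.IsCycle ∧
    c.edges.toFinset =
      (inFaces.sup id).filter fun e => (inFaces.filter fun f => e ∈ f).card = 1

/-- The edge set of a fragment. -/
def Fragment.edges {P : PlaneGraph V} (B : Fragment P) : Finset (Sym2 V) := B.inFaces.sup id

/-- The boundary edges of a fragment. -/
def Fragment.boundary {P : PlaneGraph V} (B : Fragment P) : Finset (Sym2 V) :=
  B.edges.filter fun e => (B.inFaces.filter fun f => e ∈ f).card = 1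

/-- A pentagonal fragment: all inner faces are pentagons. -/
def IsPentagonalFragment {P : PlaneGraph V} (B : Fragment P) : Prop :=
  ∀ f ∈ B.inFaces, f.card = 5

/-- The faces of `P` adjoining the subgraph with edge set `E`: not a face of the
subgraph, but sharing at least one edge with it. -/
def adjoiningFaces (P : PlaneGraph V) (E : Finset (Sym2 V)) : Finset (Finset (Sym2 V)) :=
  P.faces.filter fun f => ¬f ⊆ E ∧ (f ∩ E).Nonempty

/-- The territory `T[G]` of the subgraph with edge set `E`: the subgraph together with
all adjoining faces. -/
def territoryEdges (P : PlaneGraph V) (E : Finset (Sym2 V)) : Finset (Sym2 V) :=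
  E ∪ (adjoiningFaces P E).sup id

/-- `w(G)`: the number of 2-degree vertices of the subgraph spanned by `E`. -/
def wcount (E : Finset (Sym2 V)) : ℕ := ((edgeVerts E).filter fun v => deg E v = 2).card

/-- A subgraph is maximal in `P` when its hexagon extension is contained in `P`,
i.e. every adjoining face is a hexagon. -/
def IsMaximalIn (P : PlaneGraph V) (E : Finset (Sym2 V)) : Prop :=
  ∀ f ∈ adjoiningFaces P E, f.card = 6

/-- `H ∈ 𝒮(G)` for the subgraph `G` with edge set `E`: `H` is a set of mutually disjoint
hexagons of the hexagon extension `H[G]` (hexagonal faces sharing at least one edge with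
`G`) such that `G − H` has a matching covering all remaining 3-degree vertices of `G`. -/
def SextetAdm (P : PlaneGraph V) (E : Finset (Sym2 V)) (H : Finset (Finset (Sym2 V))) : Prop :=
  (∀ f ∈ H, f ∈ P.faces ∧ f.card = 6 ∧ (f ∩ E).Nonempty) ∧
  (∀ f ∈ H, ∀ g ∈ H, f ≠ g → Disjoint (edgeVerts f) (edgeVerts g)) ∧
  ∃ M : Finset (Sym2 V), M ⊆ E ∧ IsMatching M ∧
    (∀ e ∈ M, ∀ v : V, v ∈ e → v ∉ facesVerts H) ∧
    ∀ v ∈ edgeVerts E, deg E v = 3 → v ∉ facesVerts H → ∃ e ∈ M, v ∈ e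

/-- `U_H(G) = V(G) ∖ V(H)`. -/
def Uset (E : Finset (Sym2 V)) (H : Finset (Finset (Sym2 V))) : Finset V :=
  edgeVerts E \ facesVerts H

/-- A Clar set of `H[G]`: a member of `𝒮(G)` minimizing `|U_H(G)|`. -/
def IsClarSet (P : PlaneGraph V) (E : Finset (Sym2 V)) (H : Finset (Finset (Sym2 V))) : Prop :=
  SextetAdm P E H ∧ ∀ H', SextetAdm P E H' → (Uset E H).card ≤ (Uset E H').card

/-- A normal Clar set: a Clar set such that `G − H` has a perfect matching. -/
def IsNormalClarSet (P : PlaneGraph V) (E : Finset (Sym2 V))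
    (H : Finset (Finset (Sym2 V))) : Prop :=
  IsClarSet P E H ∧ ∃ M : Finset (Sym2 V), M ⊆ E ∧ IsMatching M ∧
    (∀ e ∈ M, ∀ v : V, v ∈ e → v ∉ facesVerts H) ∧
    ∀ v ∈ Uset E H, ∃ e ∈ M, v ∈ e

/-- The pentagonal faces of the subgraph with edge set `E`. -/
def pentFaces (P : PlaneGraph V) (E : Finset (Sym2 V)) : Finset (Finset (Sym2 V)) :=
  P.faces.filter fun f => f.card = 5 ∧ f ⊆ E

/-- A subgraph with `k` pentagons is extremal if `|U_H(G)| = k` for a Clar set `H`. -/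
def IsExtremalSub (P : PlaneGraph V) (E : Finset (Sym2 V)) : Prop :=
  ∃ H, IsClarSet P E H ∧ (Uset E H).card = (pentFaces P E).card

/-- A pentagonal ring `R_k`: `k` pentagonal faces `R 0, …, R (k-1)` such that
`R i` and `R j` intersect iff `|i − j| = 1 (mod k)`. -/
def IsPentRing (P : PlaneGraph V) (k : ℕ) (R : ZMod k → Finset (Sym2 V)) : Prop :=
  Function.Injective R ∧ (∀ i, R i ∈ P.faces ∧ (R i).card = 5) ∧
  ∀ i j : ZMod k, i ≠ j →
    ((edgeVerts (R i) ∩ edgeVerts (R j)).Nonempty ↔ (j = i + 1 ∨ i = j + 1))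

/-- The number of pentagons of the pentagonal fragment `B` adjoining (sharing an edge
with) the pentagon `p`. -/
def pentAdjCount {P : PlaneGraph V} (B : Fragment P) (p : Finset (Sym2 V)) : ℕ :=
  (B.inFaces.filter fun q => q ≠ p ∧ (q ∩ p).Nonempty).card

/-- The fragment consisting of a single pentagon `P`. -/
def IsPentagonFrag {P : PlaneGraph V} (B : Fragment P) : Prop :=
  IsPentagonalFragment B ∧ B.inFaces.card = 1

/-- `B_2`: the extremal pentagonal fragment with 4 pentagons whose Clar extension is
normal. -/
def IsB2Frag {P : PlaneGraph V} (B : Fragment P) : Prop :=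
  IsPentagonalFragment B ∧ B.inFaces.card = 4 ∧ IsExtremalSub P B.edges ∧
    ∃ H, IsNormalClarSet P B.edges H

/-- `B_3`: the extremal pentagonal fragment with 6 pentagons whose Clar extension is
normal. -/
def IsB3Frag {P : PlaneGraph V} (B : Fragment P) : Prop :=
  IsPentagonalFragment B ∧ B.inFaces.card = 6 ∧ IsExtremalSub P B.edges ∧
    ∃ H, IsNormalClarSet P B.edges H

/-- A pasting edge of the subgraph with edge set `E`: an edge of `E` lying on the
boundary of the Clar extension `C[G]` (not an edge of a Clar hexagon) whose two
end-vertices belong to `V(H)` for a Clar set `H`. -/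
def IsPastingEdge (P : PlaneGraph V) (E : Finset (Sym2 V)) (e : Sym2 V) : Prop :=
  e ∈ E ∧ ∃ H, IsClarSet P E H ∧ (∀ v : V, v ∈ e → v ∈ facesVerts H) ∧ e ∉ H.sup id

/-- `B` arises from pasting `A` and `C` along a common pasting edge:
`B = A ∪ C` and `A ∩ C` is a single pasting edge of both. -/
def IsPasting {P : PlaneGraph V} (B A C : Fragment P) : Prop :=
  B.inFaces = A.inFaces ∪ C.inFaces ∧
  ∃ e : Sym2 V, A.edges ∩ C.edges = {e} ∧ IsPastingEdge P A.edges e ∧ IsPastingEdge P C.edges e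

def IsBasicFrag {P : PlaneGraph V} (B : Fragment P) : Prop :=
  IsPentagonFrag B ∨ IsB2Frag B ∨ IsB3Frag B

/-- The pentagonal fragments generated from `P`, `B_2`, `B_3` by the pasting operation. -/
inductive Pasted (P : PlaneGraph V) : Fragment P → Prop
  | base (B : Fragment P) : IsBasicFrag B → Pasted P B
  | paste (B A C : Fragment P) : Pasted P A → IsBasicFrag C → IsPasting B A C → Pasted P B

/-- `P ∗ P`. -/
def IsPPFrag {P : PlaneGraph V} (B : Fragment P) : Prop :=
  ∃ A C : Fragment P, IsPentagonFrag A ∧ IsPentagonFrag C ∧ IsPasting B A C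

/-- `P ∗ B_2`. -/
def IsPB2Frag {P : PlaneGraph V} (B : Fragment P) : Prop :=
  ∃ A C : Fragment P, IsPentagonFrag A ∧ IsB2Frag C ∧ IsPasting B A C

/-- `P ∗ B_2 ∗ P`. -/
def IsPB2PFrag {P : PlaneGraph V} (B : Fragment P) : Prop :=
  ∃ B' A C D : Fragment P, IsPentagonFrag A ∧ IsB2Frag C ∧ IsPentagonFrag D ∧
    IsPasting B' A C ∧ IsPasting B B' D

/-- The six members of `𝓑_{≥60}`. -/
def SixShapes {P : PlaneGraph V} (B : Fragment P) : Prop :=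
  IsPentagonFrag B ∨ IsB2Frag B ∨ IsB3Frag B ∨ IsPPFrag B ∨ IsPB2Frag B ∨ IsPB2PFrag B

/-- `B_1`: two vertex-disjoint pentagons joined by an edge. -/
def IsB1 (P : PlaneGraph V) (E : Finset (Sym2 V)) : Prop :=
  ∃ (f g : Finset (Sym2 V)) (a b : V), f ∈ P.faces ∧ g ∈ P.faces ∧ f.card = 5 ∧ g.card = 5 ∧
    Disjoint (edgeVerts f) (edgeVerts g) ∧ P.graph.Adj a b ∧
    a ∈ edgeVerts f ∧ b ∈ edgeVerts g ∧ E = f ∪ g ∪ {s(a, b)}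

/-- `B_1^k`: `k` copies of `B_1` pasted together along pasting edges of their pentagons. -/
inductive B1Pow (P : PlaneGraph V) : ℕ → Finset (Sym2 V) → Prop
  | one (E : Finset (Sym2 V)) : IsB1 P E → B1Pow P 1 E
  | succ (k : ℕ) (E X : Finset (Sym2 V)) (e : Sym2 V) (f g : Finset (Sym2 V)) :
      B1Pow P k E → IsB1 P X → E ∩ X = {e} → f ∈ P.faces → g ∈ P.faces →
      f.card = 5 → g.card = 5 → f ⊆ E → g ⊆ X → e ∈ f → e ∈ g →
      IsPastingEdge P f e → IsPastingEdge P g e → B1Pow P (k + 1) (E ∪ X)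

/-- `F` contains `B_1^k` for some `2 ≤ k ≤ 4` as a subgraph. -/
def ContainsB1Pow (P : PlaneGraph V) : Prop :=
  ∃ (k : ℕ) (E : Finset (Sym2 V)), 2 ≤ k ∧ k ≤ 4 ∧ B1Pow P k E

/-- A perfect matching of the plane graph `P`. -/
def IsPerfectMatching (P : PlaneGraph V) (M : Finset (Sym2 V)) : Prop :=
  (∀ e ∈ M, e ∈ P.graph.edgeSet) ∧ IsMatching M ∧ ∀ v : V, ∃ e ∈ M, v ∈ e

/-- A sextet pattern of `P`: mutually disjoint hexagonal faces, all alternating with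
respect to a common perfect matching. -/
def IsSextetPattern (P : PlaneGraph V) (H : Finset (Finset (Sym2 V))) : Prop :=
  (∀ f ∈ H, f ∈ P.faces ∧ f.card = 6) ∧
  (∀ f ∈ H, ∀ g ∈ H, f ≠ g → Disjoint (edgeVerts f) (edgeVerts g)) ∧
  ∃ M : Finset (Sym2 V), IsPerfectMatching P M ∧ ∀ f ∈ H, (f ∩ M).card = 3

/-- A Clar formula: a maximum sextet pattern. -/
def IsClarFormula (P : PlaneGraph V) (H : Finset (Finset (Sym2 V))) : Prop :=
  IsSextetPattern P H ∧ ∀ H', IsSextetPattern P H' → H'.card ≤ H.card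

/-- An extremal fullerene graph: the Clar number equals `(n − 12)/6`. -/
def IsExtremalFullerene (P : PlaneGraph V) : Prop :=
  ∃ H, IsClarFormula P H ∧ 6 * H.card = Fintype.card V - 12

/-- The edges of the union of all maximal pentagonal fragments of `P`. -/
noncomputable def maxPentEdges (P : PlaneGraph V) : Finset (Sym2 V) :=
  @Finset.filter _
    (fun e => ∃ B : Fragment P, IsPentagonalFragment B ∧ IsMaximalIn P B.edges ∧ e ∈ B.edges)
    (Classical.decPred _) (P.faces.sup id)

/-- The disjoint union of two copies of `K_2`. -/
def twoK2 : SimpleGraph (Fin 4) := SimpleGraph.fromEdgeSet {s(0, 1), s(2, 3)}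

/-- The tree `T_0` on six vertices: two adjacent 3-degree vertices, each also adjacent
to two leaves. -/
def treeT0 : SimpleGraph (Fin 6) :=
  SimpleGraph.fromEdgeSet {s(0, 1), s(0, 2), s(0, 3), s(1, 4), s(1, 5)}



set_option linter.unusedSectionVars false

/-! ### Local structure of faces -/

lemma walk_closed {G : SimpleGraph V} (S : Set (Sym2 V)) {u v : V} (p : G.Walk u v)
    (hcl : ∀ x y z, s(x, y) ∈ S → s(y, z) ∈ p.edges → s(y, z) ∈ S)
    (hne : ∃ e ∈ p.edges, e ∈ S) : ∀ e ∈ p.edges, e ∈ S := by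
  induction p with
  | nil => simp
  | @cons u v w h p ih =>
    have hcl' : ∀ x y z, s(x, y) ∈ S → s(y, z) ∈ p.edges → s(y, z) ∈ S := by
      intro x y z h1 h2
      exact hcl x y z h1 (by simp [h2])
    cases p with
    | nil => simpa using hne
    | @cons _ v' _ h' p' =>
      have key : s(u, v) ∈ S ↔ s(v, v') ∈ S := by
        constructor
        · intro hh
          exact hcl u v v' hh (by simp)
        · intro hh
          have := hcl v' v u (by rw [Sym2.eq_swap]; exact hh) (by simp [Sym2.eq_swap])
          rw [Sym2.eq_swap]; exact this
      have all : ∀ e ∈ (SimpleGraph.Walk.cons h' p').edges, e ∈ S := by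
        apply ih hcl'
        obtain ⟨e, he, heS⟩ := hne
        rw [SimpleGraph.Walk.edges_cons, List.mem_cons] at he
        rcases he with rfl | he
        · exact ⟨s(v, v'), by simp, key.1 heS⟩
        · exact ⟨e, he, heS⟩
      intro e he
      rw [SimpleGraph.Walk.edges_cons, List.mem_cons] at he
      rcases he with rfl | he
      · exact key.2 (all _ (by simp))
      · exact all e he

/-- `C` is the edge set of a cycle. -/
def CycSet (G : SimpleGraph V) (C : Finset (Sym2 V)) : Prop :=
  ∃ (v : V) (c : G.Walk v v), c.IsCycle ∧ c.edges.toFinset = C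

lemma CycSet.other {G : SimpleGraph V} {f : Finset (Sym2 V)} (hf : CycSet G f) {a b : V}
    (hab : s(a, b) ∈ f) : ∃ c, c ≠ a ∧ s(b, c) ∈ f ∧ ∀ d, s(b, d) ∈ f → d = a ∨ d = c := by
  obtain ⟨v, c, hc, rfl⟩ := hf
  simp only [List.mem_toFinset] at *
  have hb : b ∈ c.support := c.snd_mem_support_of_mem_edges hab
  have h2 := hc.ncard_neighborSet_toSubgraph_eq_two hb
  obtain ⟨x, y, hxy, hs⟩ := Set.ncard_eq_two.1 h2
  have hm : ∀ d, s(b, d) ∈ c.edges ↔ d = x ∨ d = y := by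
    intro d
    have : d ∈ c.toSubgraph.neighborSet b ↔ d = x ∨ d = y := by rw [hs]; simp
    rw [← this, SimpleGraph.Subgraph.mem_neighborSet, SimpleGraph.Walk.adj_toSubgraph_iff_mem_edges]
  have ha : s(b, a) ∈ c.edges := by rw [Sym2.eq_swap]; exact hab
  rcases (hm a).1 ha with rfl | rfl
  · exact ⟨y, hxy.symm, (hm y).2 (Or.inr rfl), fun d hd => (hm d).1 hd⟩
  · exact ⟨x, hxy, (hm x).2 (Or.inl rfl), fun d hd => ((hm d).1 hd).symm⟩

lemma CycSet.closed {G : SimpleGraph V} {f : Finset (Sym2 V)} (hf : CycSet G f)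
    (S : Finset (Sym2 V)) (hS : S ⊆ f) (hne : S.Nonempty)
    (hcl : ∀ x y z, s(x, y) ∈ S → s(y, z) ∈ f → s(y, z) ∈ S) : S = f := by
  obtain ⟨v, c, hc, rfl⟩ := hf
  apply Finset.Subset.antisymm hS
  intro e he
  have := walk_closed (S : Set (Sym2 V)) c
    (by intro x y z h1 h2; exact hcl x y z h1 (by simpa using h2))
    (by obtain ⟨e, he⟩ := hne; exact ⟨e, by simpa using hS he, he⟩)
  exact this e (by simpa using he)

lemma CycSet.nonempty {G : SimpleGraph V} {f : Finset (Sym2 V)} (hf : CycSet G f) :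
    f.Nonempty := by
  obtain ⟨v, c, hc, rfl⟩ := hf
  have := hc.three_le_length
  rw [← SimpleGraph.Walk.length_edges] at this
  obtain ⟨e, he⟩ := List.exists_mem_of_length_pos (by omega : 0 < c.edges.length)
  exact ⟨e, by simpa using he⟩

lemma mem_edgeVerts {E : Finset (Sym2 V)} {v : V} : v ∈ edgeVerts E ↔ ∃ w, s(v, w) ∈ E := by
  simp only [edgeVerts, Finset.mem_filter, Finset.mem_univ, true_and]
  constructor
  · rintro ⟨e, he, hv⟩
    obtain ⟨w, rfl⟩ := Sym2.mem_iff_exists.1 hv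
    exact ⟨w, he⟩
  · rintro ⟨w, hw⟩
    exact ⟨_, hw, by simp⟩

lemma PlaneGraph.fc (P : PlaneGraph V) {f : Finset (Sym2 V)} (hf : f ∈ P.faces) :
    CycSet P.graph f := P.face_cycle f hf

lemma PlaneGraph.adj (P : PlaneGraph V) {f : Finset (Sym2 V)} (hf : f ∈ P.faces) {a b : V}
    (h : s(a, b) ∈ f) : P.graph.Adj a b := P.face_edges f hf _ h

/-- Parametrization of a pentagonal face starting from a given edge. -/
lemma pent_param (P : PlaneGraph V) {f : Finset (Sym2 V)} (hf : f ∈ P.faces) (h5 : f.card = 5)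
    {a b : V} (hab : s(a, b) ∈ f) : ∃ c d e, a ≠ b ∧ a ≠ c ∧ a ≠ d ∧ a ≠ e ∧ b ≠ c ∧ b ≠ d ∧ b ≠ e ∧
      c ≠ d ∧ c ≠ e ∧ d ≠ e ∧ f = {s(a, b), s(b, c), s(c, d), s(d, e), s(e, a)} := by
  have hc := P.fc hf
  have nab := (P.adj hf hab).ne
  obtain ⟨c, hca, hbc, ub⟩ := hc.other hab
  have nbc := (P.adj hf hbc).ne
  obtain ⟨d, hdb, hcd, uc⟩ := hc.other hbc
  have ncd := (P.adj hf hcd).ne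
  obtain ⟨e, hec, hde, ud⟩ := hc.other hcd
  have nde := (P.adj hf hde).ne
  have sw : ∀ {x y : V}, s(x, y) ∈ f → s(y, x) ∈ f := fun h => by rw [Sym2.eq_swap]; exact h
  obtain ⟨a', ha'b, haa', ua⟩ := hc.other (sw hab)
  have hda : d ≠ a := by
    rintro rfl
    have : ({s(d, b), s(b, c), s(c, d)} : Finset (Sym2 V)) = f := by
      apply hc.closed
      · intro x hx; simp at hx; rcases hx with rfl | rfl | rfl <;> assumption
      · simp
      · have ha' : c = a' := (ua c (sw hcd)).resolve_left nbc.symm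
        intro x y z h1 h2
        have hy : y = d ∨ y = b ∨ y = c := by
          simp only [Finset.mem_insert, Finset.mem_singleton, Sym2.eq_iff] at h1
          tauto
        rcases hy with hy | hy | hy <;> subst hy
        · rcases ua z h2 with h | h
          · simp [h]
          · simp [h, ← ha', Sym2.eq_swap]
        · rcases ub z h2 with h | h
          · simp [h, Sym2.eq_swap]
          · simp [h]
        · rcases uc z h2 with h | h
          · simp [h, Sym2.eq_swap]
          · simp [h]
    have h3 := Finset.card_le_three (a := s(d,b)) (b := s(b,c)) (c := s(c,d))
    rw [this] at h3; omega
  have heb : e ≠ b := by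
    rintro rfl
    rcases ub d (sw hde) with h | h
    · exact hda h
    · exact ncd h.symm
  have hea : e ≠ a := by
    rintro rfl
    have : ({s(e, b), s(b, c), s(c, d), s(d, e)} : Finset (Sym2 V)) = f := by
      apply hc.closed
      · intro x hx; simp at hx; rcases hx with rfl | rfl | rfl | rfl <;> assumption
      · simp
      · have ha' : d = a' := (ua d (sw hde)).resolve_left hdb
        intro x y z h1 h2
        have hy : y = e ∨ y = b ∨ y = c ∨ y = d := by
          simp only [Finset.mem_insert, Finset.mem_singleton, Sym2.eq_iff] at h1
          tauto
        rcases hy with hy | hy | hy | hy <;> subst hy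
        · rcases ua z h2 with h | h
          · simp [h]
          · simp [h, ← ha', Sym2.eq_swap]
        · rcases ub z h2 with h | h
          · simp [h, Sym2.eq_swap]
          · simp [h]
        · rcases uc z h2 with h | h
          · simp [h, Sym2.eq_swap]
          · simp [h]
        · rcases ud z h2 with h | h
          · simp [h, Sym2.eq_swap]
          · simp [h]
    have h3 := Finset.card_le_four (a := s(e,b)) (b := s(b,c)) (c := s(c,d)) (d := s(d,e))
    rw [this] at h3; omega
  obtain ⟨g, hgd, heg, ue⟩ := hc.other hde
  have neg := (P.adj hf heg).ne
  have hcard : ({s(a, b), s(b, c), s(c, d), s(d, e), s(e, g)} : Finset (Sym2 V)).card = 5 := by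
    repeat rw [Finset.card_insert_of_notMem]
    · simp
    all_goals simp only [Finset.mem_insert, Finset.mem_singleton, Sym2.eq_iff]; clear ua ub uc ud ue sw; grind
  have hfeq : ({s(a, b), s(b, c), s(c, d), s(d, e), s(e, g)} : Finset (Sym2 V)) = f := by
    apply Finset.eq_of_subset_of_card_le
    · intro x hx; simp at hx; rcases hx with rfl | rfl | rfl | rfl | rfl <;> assumption
    · omega
  have hga : g = a := by
    have := haa'
    rw [← hfeq] at this
    simp only [Finset.mem_insert, Finset.mem_singleton, Sym2.eq_iff] at this
    clear ua ub uc ud ue sw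
    grind
  subst hga
  exact ⟨c, d, e, nab, hca.symm, hda.symm, hea.symm, nbc, hdb.symm, heb.symm, ncd, hec.symm, nde,
    hfeq.symm⟩

/-! ### Local structure at vertices -/

lemma nbrs {P : PlaneGraph V} (hP : IsFullerene P) (v : V) : ∃ a b c, a ≠ b ∧ a ≠ c ∧ b ≠ c ∧
    ∀ x, P.graph.Adj v x ↔ x = a ∨ x = b ∨ x = c := by
  obtain ⟨a, b, c, h1, h2, h3, h⟩ := Set.ncard_eq_three.1 (hP.cubic v)
  refine ⟨a, b, c, h1, h2, h3, fun x => ?_⟩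
  rw [← SimpleGraph.mem_neighborSet, h]; simp

lemma third {P : PlaneGraph V} (hP : IsFullerene P) {v a b : V} (ha : P.graph.Adj v a)
    (hb : P.graph.Adj v b) (hab : a ≠ b) : ∃ c, c ≠ a ∧ c ≠ b ∧
    ∀ x, P.graph.Adj v x ↔ x = a ∨ x = b ∨ x = c := by
  obtain ⟨x, y, z, h1, h2, h3, h⟩ := nbrs hP v
  have ha' := (h a).1 ha
  have hb' := (h b).1 hb
  rcases ha' with rfl | rfl | rfl <;> rcases hb' with rfl | rfl | rfl <;> try (exact absurd rfl hab)
  · exact ⟨z, h2.symm, h3.symm, h⟩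
  · exact ⟨y, h1.symm, h3, fun x => by rw [h]; tauto⟩
  · exact ⟨z, h3.symm, h2.symm, fun x => by rw [h]; tauto⟩
  · exact ⟨x, h1, h2, fun x => by rw [h]; tauto⟩
  · exact ⟨y, h3, h1.symm, fun x => by rw [h]; tauto⟩
  · exact ⟨x, h2, h1, fun x => by rw [h]; tauto⟩

lemma edge_two (P : PlaneGraph V) {e : Sym2 V} (he : e ∈ P.graph.edgeSet) :
    ∃ f g, f ≠ g ∧ f ∈ P.faces ∧ g ∈ P.faces ∧ e ∈ f ∧ e ∈ g ∧
      ∀ h ∈ P.faces, e ∈ h → h = f ∨ h = g := by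
  obtain ⟨f, g, hfg, h⟩ := Finset.card_eq_two.1 (P.edge_faces e he)
  have hm : ∀ k, (k ∈ P.faces ∧ e ∈ k) ↔ k = f ∨ k = g := by
    intro k
    have : k ∈ P.faces.filter (fun f => e ∈ f) ↔ k = f ∨ k = g := by rw [h]; simp
    rwa [Finset.mem_filter] at this
  have hf := (hm f).2 (Or.inl rfl)
  have hg := (hm g).2 (Or.inr rfl)
  exact ⟨f, g, hfg, hf.1, hg.1, hf.2, hg.2, fun k h1 h2 => (hm k).1 ⟨h1, h2⟩⟩

lemma no_three (P : PlaneGraph V) {f : Finset (Sym2 V)} (hf : f ∈ P.faces) {v a b c : V}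
    (ha : s(v, a) ∈ f) (hb : s(v, b) ∈ f) (hc : s(v, c) ∈ f) (hab : a ≠ b) : c = a ∨ c = b := by
  rw [Sym2.eq_swap] at ha
  obtain ⟨d, hd, h1, h2⟩ := (P.fc hf).other ha
  rcases h2 b hb with h | h
  · exact absurd h.symm hab
  · subst h; exact h2 c hc

/-- Another edge of the face at `v`. -/
lemma face_next (P : PlaneGraph V) {f : Finset (Sym2 V)} (hf : f ∈ P.faces) {v a : V}
    (ha : s(v, a) ∈ f) : ∃ b, b ≠ a ∧ s(v, b) ∈ f := by
  rw [Sym2.eq_swap] at ha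
  obtain ⟨d, hd, h1, h2⟩ := (P.fc hf).other ha
  exact ⟨d, hd, h1⟩

lemma face_hit {P : PlaneGraph V} (hP : IsFullerene P) {f : Finset (Sym2 V)} (hf : f ∈ P.faces)
    {v a b : V} (hv : v ∈ edgeVerts f) (ha : P.graph.Adj v a)
    (hb : P.graph.Adj v b) (hab : a ≠ b) : s(v, a) ∈ f ∨ s(v, b) ∈ f := by
  obtain ⟨x, hx⟩ := mem_edgeVerts.1 hv
  obtain ⟨y, hy, hyf⟩ := face_next P hf hx
  obtain ⟨c, h1, h2, h⟩ := third hP ha hb hab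
  rcases (h x).1 (P.adj hf hx) with rfl | rfl | rfl
  · exact Or.inl hx
  · exact Or.inr hx
  · rcases (h y).1 (P.adj hf hyf) with rfl | rfl | rfl
    · exact Or.inl hyf
    · exact Or.inr hyf
    · exact absurd rfl hy

lemma pair_unique {P : PlaneGraph V} (hP : IsFullerene P) {f g : Finset (Sym2 V)}
    (hf : f ∈ P.faces) (hg : g ∈ P.faces) {v a b : V} (hab : a ≠ b)
    (h1 : s(v, a) ∈ f) (h2 : s(v, b) ∈ f) (h3 : s(v, a) ∈ g) (h4 : s(v, b) ∈ g) : f = g := by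
  by_contra hne
  obtain ⟨c, hca, hcb, hn⟩ := third hP (P.adj hf h1) (P.adj hf h2) hab
  have hc : P.graph.Adj v c := (hn c).2 (by simp)
  obtain ⟨k, k', -, hk, -, hck, -, -⟩ := edge_two P (e := s(v, c)) hc
  have key : ∀ d, s(v, d) ∈ f → s(v, d) ∈ g → s(v, d) ∈ k → k = f ∨ k = g := by
    intro d hdf hdg hdk
    obtain ⟨x, y, hxy, hx, hy, hex, hey, hall⟩ := edge_two P (P.face_edges f hf _ hdf)
    have r1 := hall f hf hdf
    have r2 := hall g hg hdg
    have r3 := hall k hk hdk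
    grind
  have hkk : k = f ∨ k = g := by
    rcases face_hit hP hk (mem_edgeVerts.2 ⟨c, hck⟩) (P.adj hf h1) (P.adj hf h2) hab with h | h
    · exact key a h1 h3 h
    · exact key b h2 h4 h
  rcases hkk with rfl | rfl
  · rcases no_three P hk h1 h2 hck hab with h | h <;> contradiction
  · rcases no_three P hk h3 h4 hck hab with h | h <;> contradiction

lemma pair_face {P : PlaneGraph V} (hP : IsFullerene P) {v a b : V} (ha : P.graph.Adj v a)
    (hb : P.graph.Adj v b) (hab : a ≠ b) : ∃ f ∈ P.faces, s(v, a) ∈ f ∧ s(v, b) ∈ f := by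
  obtain ⟨c, hca, hcb, hn⟩ := third hP ha hb hab
  have hc : P.graph.Adj v c := (hn c).2 (by simp)
  obtain ⟨f, g, hfg, hf, hg, haf, hag, -⟩ := edge_two P (e := s(v, a)) ha
  by_cases h1 : s(v, b) ∈ f
  · exact ⟨f, hf, haf, h1⟩
  by_cases h2 : s(v, b) ∈ g
  · exact ⟨g, hg, hag, h2⟩
  have h3 := (face_hit hP hf (mem_edgeVerts.2 ⟨a, haf⟩) hb hc hcb.symm).resolve_left h1
  have h4 := (face_hit hP hg (mem_edgeVerts.2 ⟨a, hag⟩) hb hc hcb.symm).resolve_left h2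
  exact absurd (pair_unique hP hf hg hca.symm haf h3 hag h4) hfg

lemma share_edge {P : PlaneGraph V} (hP : IsFullerene P) {f g : Finset (Sym2 V)}
    (hf : f ∈ P.faces) (hg : g ∈ P.faces) {v : V} (h1 : v ∈ edgeVerts f) (h2 : v ∈ edgeVerts g) :
    ∃ x, s(v, x) ∈ f ∧ s(v, x) ∈ g := by
  obtain ⟨x, hx⟩ := mem_edgeVerts.1 h1
  obtain ⟨y, hy, hyf⟩ := face_next P hf hx
  rcases face_hit hP hg h2 (P.adj hf hx) (P.adj hf hyf) hy.symm with h | h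
  · exact ⟨x, hx, h⟩
  · exact ⟨y, hyf, h⟩

/-! ### Connectivity -/

lemma conn_closed {W : Type} {G : SimpleGraph W} (hG : G.Connected) (S : Set W)
    (hcl : ∀ x ∈ S, ∀ y, G.Adj x y → y ∈ S) {x : W} (hx : x ∈ S) (y : W) : y ∈ S := by
  obtain ⟨w⟩ := hG.preconnected x y
  induction w with
  | nil => exact hx
  | cons h p ih => exact ih (hcl _ hx _ h)

lemma cut {P : PlaneGraph V} (hP : IsFullerene P) (S : Set V) (a b : V) (ha : a ∉ S) (hb : b ∉ S)
    (hcl : ∀ x ∈ S, ∀ y, P.graph.Adj x y → y ∈ S ∨ y = a ∨ y = b) {x : V} (hx : x ∈ S)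
    {z : V} (hz : z ∉ S) (hza : z ≠ a) (hzb : z ≠ b) : False := by
  have hc := hP.threeConnected {a, b} ((Set.ncard_insert_le a {b}).trans
    (by rw [Set.ncard_singleton]))
  have hxs : x ∈ ({a, b} : Set V)ᶜ := by
    simp only [Set.mem_compl_iff, Set.mem_insert_iff, Set.mem_singleton_iff]
    rintro (rfl | rfl) <;> contradiction
  have hzs : z ∈ ({a, b} : Set V)ᶜ := by
    simp only [Set.mem_compl_iff, Set.mem_insert_iff, Set.mem_singleton_iff]
    tauto
  have := conn_closed hc {w | (w : V) ∈ S} (by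
    intro w hw y hwy
    have hy := y.2
    simp only [Set.mem_compl_iff, Set.mem_insert_iff, Set.mem_singleton_iff] at hy
    have := hcl w hw y hwy
    simp only [Set.mem_ofPred_eq]
    tauto) (x := ⟨x, hxs⟩) hx ⟨z, hzs⟩
  exact hz this

lemma conn_all {P : PlaneGraph V} (hP : IsFullerene P) (S : Set V)
    (hcl : ∀ x ∈ S, ∀ y, P.graph.Adj x y → y ∈ S) {x : V} (hx : x ∈ S) (z : V) : z ∈ S := by
  have hc := hP.threeConnected ∅ (by simp)
  have := conn_closed hc {w | (w : V) ∈ S} (by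
    intro w hw y hwy
    exact hcl w hw y hwy) (x := ⟨x, by simp⟩) hx ⟨z, by simp⟩
  exact this

lemma card_V {P : PlaneGraph V} (hP : IsFullerene P) : 20 ≤ Fintype.card V := by
  have he := P.euler
  have h12 := hP.pentTwelve
  have hle : (P.faces.filter fun f => f.card = 5).card ≤ P.faces.card :=
    Finset.card_le_card (Finset.filter_subset _ _)
  have hs : (∑ f ∈ P.faces, f.card) + (P.faces.filter fun f => f.card = 5).card
      = 6 * P.faces.card := by
    rw [Finset.card_filter, ← Finset.sum_add_distrib, mul_comm, ← smul_eq_mul,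
      ← Finset.sum_const]
    apply Finset.sum_congr rfl
    intro f hf
    rcases hP.faceSize f hf with h | h <;> simp [h]
  omega

/-! ### Pairs of pentagons -/

lemma exists_out {P : PlaneGraph V} (hP : IsFullerene P) (T : Finset V) (h : T.card < 20) :
    ∃ z, z ∉ T := by
  by_contra hc
  push Not at hc
  have := Finset.eq_univ_iff_forall.2 hc
  rw [this, Finset.card_univ] at h
  have := card_V hP
  omega

lemma edgeVerts_pent (a b c d e : V) :
    edgeVerts ({s(a, b), s(b, c), s(c, d), s(d, e), s(e, a)} : Finset (Sym2 V))
      = {a, b, c, d, e} := by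
  ext v
  simp [edgeVerts]
  tauto

lemma nbr_cover {P : PlaneGraph V} (hP : IsFullerene P) {f g : Finset (Sym2 V)}
    (hf : f ∈ P.faces) (hg : g ∈ P.faces) (hfg : f ≠ g) {x : V} (h1 : x ∈ edgeVerts f)
    (h2 : x ∈ edgeVerts g) {y : V} (hy : P.graph.Adj x y) :
    y ∈ edgeVerts f ∨ y ∈ edgeVerts g := by
  obtain ⟨a, haf, hag⟩ := share_edge hP hf hg h1 h2
  obtain ⟨b, hb, hbf⟩ := face_next P hf haf
  obtain ⟨c, hc, hcg⟩ := face_next P hg hag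
  have hbc : b ≠ c := by
    rintro rfl
    exact hfg (pair_unique hP hf hg hb.symm haf hbf hag hcg)
  obtain ⟨d, hd1, hd2, hd⟩ := third hP (P.adj hf haf) (P.adj hf hbf) hb.symm
  have hcd : c = d := by
    rcases (hd c).1 (P.adj hg hcg) with h | h | h
    · exact absurd h hc
    · exact absurd h.symm hbc
    · exact h
  subst hcd
  have key : ∀ {k : Finset (Sym2 V)} {w}, s(x, w) ∈ k → w ∈ edgeVerts k := fun h =>
    mem_edgeVerts.2 ⟨x, by rwa [Sym2.eq_swap]⟩
  rcases (hd y).1 hy with rfl | rfl | rfl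
  · exact Or.inl (key haf)
  · exact Or.inl (key hbf)
  · exact Or.inr (key hcg)

lemma two_edge_core {P : PlaneGraph V} (hP : IsFullerene P) {f g : Finset (Sym2 V)}
    (hf : f ∈ P.faces) (hg : g ∈ P.faces) (hfg : f ≠ g) (g5 : g.card = 5) {a b c d e : V}
    (hd : [a, b, c, d, e].Nodup)
    (hfe : f = {s(a, b), s(b, c), s(c, d), s(d, e), s(e, a)})
    (h1 : s(a, b) ∈ g) (h2 : s(c, d) ∈ g) : False := by
  have hF : edgeVerts f = {a, b, c, d, e} := by rw [hfe, edgeVerts_pent]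
  have hgc : (edgeVerts g).card ≤ 5 := by
    obtain ⟨c', d', e', -, -, -, -, -, -, -, -, -, -, h⟩ := pent_param P hg g5 h1
    rw [h, edgeVerts_pent]
    exact Finset.card_le_five
  have ha : a ∈ edgeVerts g := mem_edgeVerts.2 ⟨_, h1⟩
  have hb : b ∈ edgeVerts g := mem_edgeVerts.2 ⟨a, by rwa [Sym2.eq_swap]⟩
  have hc : c ∈ edgeVerts g := mem_edgeVerts.2 ⟨_, h2⟩
  have hd' : d ∈ edgeVerts g := mem_edgeVerts.2 ⟨c, by rwa [Sym2.eq_swap]⟩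
  simp only [List.nodup_cons, List.mem_cons, List.not_mem_nil, not_or, or_false] at hd
  obtain ⟨⟨hab, hac, had, hae⟩, ⟨hbc, hbd, hbe⟩, ⟨hcd, hce⟩, hde, -⟩ := hd
  have h4 : ({a, b, c, d} : Finset V).card = 4 := by
    rw [Finset.card_insert_of_notMem, Finset.card_insert_of_notMem, Finset.card_pair hcd] <;>
      simp [*]
  have hsub : ({a, b, c, d} : Finset V) ⊆ edgeVerts g := by
    intro x; simp only [Finset.mem_insert, Finset.mem_singleton]
    rintro (rfl | rfl | rfl | rfl) <;> assumption
  have hle : (edgeVerts g \ {a, b, c, d}).card ≤ 1 := by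
    rw [Finset.card_sdiff_of_subset hsub]; omega
  have hw : ∃ w, w ∉ ({a, b, c, d} : Finset V) ∧
      ∀ y ∈ edgeVerts g, y ∈ ({a, b, c, d} : Finset V) ∨ y = w := by
    by_cases hne : (edgeVerts g \ {a, b, c, d}).Nonempty
    · obtain ⟨w, hw⟩ := hne
      refine ⟨w, (Finset.mem_sdiff.1 hw).2, fun y hy => ?_⟩
      by_cases hy' : y ∈ ({a, b, c, d} : Finset V)
      · exact Or.inl hy'
      · exact Or.inr (Finset.card_le_one.1 hle y (Finset.mem_sdiff.2 ⟨hy, hy'⟩) w hw)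
    · refine ⟨e, by simp [Ne.symm hae, Ne.symm hbe, Ne.symm hce, Ne.symm hde], fun y hy => ?_⟩
      left
      by_contra hy'
      exact hne ⟨y, Finset.mem_sdiff.2 ⟨hy, hy'⟩⟩
  obtain ⟨w, hw1, hw2⟩ := hw
  obtain ⟨z, hz⟩ := exists_out hP ({a, b, c, d, e, w} : Finset V)
    (lt_of_le_of_lt Finset.card_le_six (by norm_num))
  simp only [Finset.mem_insert, Finset.mem_singleton, not_or] at hz hw1
  refine cut hP (({a, b, c, d} : Finset V) : Set V) e w (by simp [Ne.symm hae, Ne.symm hbe, Ne.symm hce, Ne.symm hde])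
    (by simp [hw1]) ?_ (x := a) (by simp) (z := z) (by simp [hz]) hz.2.2.2.2.1 hz.2.2.2.2.2
  intro x hx y hxy
  rw [Finset.mem_coe] at hx
  rcases nbr_cover hP hf hg hfg (x := x) (y := y) (by
      rw [hF]; simp only [Finset.mem_insert, Finset.mem_singleton] at hx ⊢; tauto)
      (hsub hx) hxy with h | h
  · rw [hF] at h
    simp only [Finset.mem_insert, Finset.mem_singleton] at h
    simp only [Finset.mem_coe, Finset.mem_insert, Finset.mem_singleton]
    tauto
  · rcases hw2 y h with h | h
    · exact Or.inl h
    · exact Or.inr (Or.inr h)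

/-- Two distinct pentagons share at most one edge. -/
lemma two_edge {P : PlaneGraph V} (hP : IsFullerene P) {f g : Finset (Sym2 V)}
    (hf : f ∈ P.faces) (hg : g ∈ P.faces) (hfg : f ≠ g) (f5 : f.card = 5) (g5 : g.card = 5)
    {e e' : Sym2 V} (h1 : e ∈ f) (h2 : e ∈ g) (h3 : e' ∈ f) (h4 : e' ∈ g) : e = e' := by
  by_contra hne
  induction e with | h a b => ?_
  obtain ⟨c, d, e, hab, hac, had, hae, hbc, hbd, hbe, hcd, hce, hde, hfe⟩ := pent_param P hf f5 h1
  have h3' := h3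
  rw [hfe] at h3
  simp only [Finset.mem_insert, Finset.mem_singleton] at h3
  rcases h3 with h | h | h | h | h
  · exact hne h.symm
  · subst h
    rw [Sym2.eq_swap] at h1 h2
    exact hfg (pair_unique hP hf hg hac h1 h3' h2 h4)
  · subst h
    exact two_edge_core hP hf hg hfg g5 (by simp [*]) hfe h2 h4
  · subst h
    refine two_edge_core hP hf hg hfg g5 (a := b) (b := a) (c := e) (d := d) (e := c)
      (by simp [*, Ne.symm hab, Ne.symm hcd, Ne.symm hde, Ne.symm hce]) ?_
      (by rwa [Sym2.eq_swap]) (by rwa [Sym2.eq_swap])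
    rw [hfe]
    ext z
    simp only [Finset.mem_insert, Finset.mem_singleton]
    rw [Sym2.eq_swap (a := b) (b := a), Sym2.eq_swap (a := a) (b := e),
      Sym2.eq_swap (a := e) (b := d), Sym2.eq_swap (a := d) (b := c),
      Sym2.eq_swap (a := c) (b := b)]
    tauto
  · subst h
    rw [Sym2.eq_swap] at h3' h4
    exact hfg (pair_unique hP hf hg hbe h1 h3' h2 h4)

lemma two_vert {P : PlaneGraph V} (hP : IsFullerene P) {f g : Finset (Sym2 V)}
    (hf : f ∈ P.faces) (hg : g ∈ P.faces) (hfg : f ≠ g) (f5 : f.card = 5) (g5 : g.card = 5)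
    {a b x : V} (h1 : s(a, b) ∈ f) (h2 : s(a, b) ∈ g) (h3 : x ∈ edgeVerts f)
    (h4 : x ∈ edgeVerts g) : x = a ∨ x = b := by
  obtain ⟨y, hy1, hy2⟩ := share_edge hP hf hg h3 h4
  have := two_edge hP hf hg hfg f5 g5 h1 h2 hy1 hy2
  have hx : x ∈ s(a, b) := by rw [this]; simp
  simpa using hx

/-! ### The ring around a pentagon with five pentagonal neighbours -/

lemma inj_five {a b c d e : V} (hd : [a, b, c, d, e].Nodup) :
    Function.Injective (![a, b, c, d, e] : Fin 5 → V) := by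
  simp only [List.nodup_cons, List.mem_cons, List.not_mem_nil, not_or, or_false] at hd
  obtain ⟨⟨hab, hac, had, hae⟩, ⟨hbc, hbd, hbe⟩, ⟨hcd, hce⟩, hde, -⟩ := hd
  intro i j hij
  fin_cases i <;> fin_cases j <;> first | rfl | (exfalso; simp at hij; tauto)

lemma cyc_five {a b c d e : V} (i : Fin 5) :
    s((![a, b, c, d, e] : Fin 5 → V) i, (![a, b, c, d, e] : Fin 5 → V) (i + 1)) ∈
      ({s(a, b), s(b, c), s(c, d), s(d, e), s(e, a)} : Finset (Sym2 V)) := by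
  fin_cases i <;> simp [Fin.add_def]

lemma pent_cyc (P : PlaneGraph V) {p : Finset (Sym2 V)} (hp : p ∈ P.faces)
    (p5 : p.card = 5) :
    ∃ v : ZMod 5 → V, Function.Injective v ∧ ∀ i, s(v i, v (i + 1)) ∈ p := by
  obtain ⟨e, he⟩ := (P.fc hp).nonempty
  induction e with | h a b => ?_
  obtain ⟨c, d, e, hab, hac, had, hae, hbc, hbd, hbe, hcd, hce, hde, hfe⟩ :=
    pent_param P hp p5 he
  refine ⟨![a, b, c, d, e], inj_five (by simp [*]), fun i => ?_⟩
  rw [hfe]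
  exact cyc_five i

set_option maxHeartbeats 1000000 in
lemma ring_of {P : PlaneGraph V} (hP : IsFullerene P) {p : Finset (Sym2 V)} (hp : p ∈ P.faces)
    (p5 : p.card = 5) (hn : ∀ q ∈ P.faces, q ≠ p → (q ∩ p).Nonempty → q.card = 5) :
    ∃ R : ZMod 5 → Finset (Sym2 V), IsPentRing P 5 R ∧
      ∀ i, R i ∈ P.faces ∧ R i ≠ p ∧ (R i ∩ p).Nonempty := by
  obtain ⟨v, vinj, hv⟩ := pent_cyc P hp p5
  have z41 : ∀ i : ZMod 5, i + 4 + 1 = i := by decide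
  have z14 : ∀ i : ZMod 5, i + 1 + 4 = i := by decide
  have hv4 : ∀ i, s(v i, v (i + 4)) ∈ p := by
    intro i; have := hv (i + 4); rw [z41, Sym2.eq_swap] at this; exact this
  have z1 : ∀ i : ZMod 5, i + 1 ≠ i + 4 := by decide
  have hu : ∀ i, ∃ u, u ≠ v (i + 1) ∧ u ≠ v (i + 4) ∧
      ∀ x, P.graph.Adj (v i) x ↔ x = v (i + 1) ∨ x = v (i + 4) ∨ x = u := fun i =>
    third hP (P.adj hp (hv i)) (P.adj hp (hv4 i)) (fun h => z1 i (vinj h))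
  choose u hu1 hu4 hN using hu
  have hR : ∀ i, ∃ q ∈ P.faces, q ≠ p ∧ s(v i, v (i + 1)) ∈ q := by
    intro i
    obtain ⟨f, g, hfg, hf, hg, h1, h2, hall⟩ := edge_two P (P.face_edges p hp _ (hv i))
    by_cases h : f = p
    · exact ⟨g, hg, fun h' => hfg (h.trans h'.symm), h2⟩
    · exact ⟨f, hf, h, h1⟩
  choose R hRf hRp hRe using hR
  have hRne : ∀ i, (R i ∩ p).Nonempty := fun i => ⟨_, Finset.mem_inter.2 ⟨hRe i, hv i⟩⟩
  have hR5 : ∀ i, (R i).card = 5 := fun i => hn _ (hRf i) (hRp i) (hRne i)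
  have hRu : ∀ i, s(v i, u i) ∈ R i := by
    intro i
    obtain ⟨b, hb, hbR⟩ := face_next P (hRf i) (hRe i)
    rcases (hN i b).1 (P.adj (hRf i) hbR) with h | h | h
    · exact absurd h hb
    · subst h
      exact absurd (pair_unique hP (hRf i) hp hb.symm (hRe i) hbR (hv i) (hv4 i)) (hRp i)
    · rwa [← h]
  have hRu1 : ∀ i, s(v (i + 1), u (i + 1)) ∈ R i := by
    intro i
    have e1 : s(v (i + 1), v i) ∈ R i := by rw [Sym2.eq_swap]; exact hRe i
    have e2 : s(v (i + 1), v i) ∈ p := by rw [Sym2.eq_swap]; exact hv i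
    obtain ⟨b, hb, hbR⟩ := face_next P (hRf i) e1
    rcases (hN (i + 1) b).1 (P.adj (hRf i) hbR) with h | h | h
    · subst h
      exact absurd (pair_unique hP (hRf i) hp hb.symm e1 hbR e2 (hv _)) (hRp i)
    · rw [z14] at h; exact absurd h hb
    · rwa [← h]
  have hw : ∀ i, ∃ w, [v i, v (i + 1), u (i + 1), w, u i].Nodup ∧
      R i = {s(v i, v (i + 1)), s(v (i + 1), u (i + 1)), s(u (i + 1), w), s(w, u i),
        s(u i, v i)} := by
    intro i
    obtain ⟨c, d, e, hab, hac, had, hae, hbc, hbd, hbe, hcd, hce, hde, hfe⟩ :=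
      pent_param P (hRf i) (hR5 i) (hRe i)
    have hc : u (i + 1) = c := by
      have := no_three P (hRf i) (v := v (i + 1)) (a := v i) (b := c) (c := u (i + 1))
        (by rw [Sym2.eq_swap]; exact hRe i) (by rw [hfe]; simp) (hRu1 i) hac
      refine this.resolve_left fun h => ?_
      have h2 := hu4 (i + 1)
      rw [z14] at h2
      exact h2 h
    have he : u i = e := by
      have := no_three P (hRf i) (v := v i) (a := v (i + 1)) (b := e) (c := u i)
        (hRe i) (by rw [hfe, Sym2.eq_swap]; simp) (hRu i) hbe
      exact this.resolve_left (hu1 i)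
    refine ⟨d, ?_, ?_⟩
    · rw [hc, he]; simp [*]
    · rw [hc, he]; exact hfe
  choose w hwd hwR using hw
  have hEV : ∀ i, edgeVerts (R i) = {v i, v (i + 1), u (i + 1), w i, u i} := fun i => by
    rw [hwR i, edgeVerts_pent]
  have hpv : ∀ i, v i ∈ edgeVerts p := fun i => mem_edgeVerts.2 ⟨_, hv i⟩
  have hdist : ∀ i, (v i ≠ u i ∧ v i ≠ u (i + 1) ∧ v i ≠ w i ∧ v (i + 1) ≠ u i ∧
      v (i + 1) ≠ u (i + 1) ∧ v (i + 1) ≠ w i ∧ u i ≠ u (i + 1) ∧ w i ≠ u i ∧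
      w i ≠ u (i + 1)) := by
    intro i
    have := hwd i
    simp only [List.nodup_cons, List.mem_cons, List.not_mem_nil, not_or, or_false] at this
    obtain ⟨⟨h1, h2, h3, h4⟩, ⟨h5, h6, h7⟩, ⟨h8, h9⟩, h10, -⟩ := this
    exact ⟨h4, h2, h3, h7, h5, h6, Ne.symm h9, h10, Ne.symm h8⟩
  -- `u` and `w` avoid `p`
  have huv : ∀ i j, u i ≠ v j := by
    intro i j h
    obtain ⟨d1, d2, d3, d4, d5, d6, d7, d8, d9⟩ := hdist i
    rcases two_vert hP (hRf i) hp (hRp i) (hR5 i) p5 (hRe i) (hv i) (x := u i)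
      (by rw [hEV]; simp) (by rw [h]; exact hpv j) with h' | h'
    · exact d1 h'.symm
    · exact d4 h'.symm
  have hwv : ∀ i j, w i ≠ v j := by
    intro i j h
    obtain ⟨d1, d2, d3, d4, d5, d6, d7, d8, d9⟩ := hdist i
    rcases two_vert hP (hRf i) hp (hRp i) (hR5 i) p5 (hRe i) (hv i) (x := w i)
      (by rw [hEV]; simp) (by rw [h]; exact hpv j) with h' | h'
    · exact d3 h'.symm
    · exact d6 h'.symm
  have Rinj : Function.Injective R := by
    intro i j hij
    by_contra hne
    have h1 := two_vert hP (hRf i) hp (hRp i) (hR5 i) p5 (hRe i) (hv i) (x := v j)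
      (by rw [hij, hEV]; simp) (hpv _)
    have h2 := two_vert hP (hRf i) hp (hRp i) (hR5 i) p5 (hRe i) (hv i) (x := v (j + 1))
      (by rw [hij, hEV]; simp) (hpv _)
    have h1' : j = i ∨ j = i + 1 := h1.imp (fun h => vinj h) (fun h => vinj h)
    have h2' : j + 1 = i ∨ j + 1 = i + 1 := h2.imp (fun h => vinj h) (fun h => vinj h)
    clear * - hne h1' h2'
    revert i j; decide
  have hcons : ∀ i x, x ∈ edgeVerts (R i) → x ∈ edgeVerts (R (i + 1)) →
      x = v (i + 1) ∨ x = u (i + 1) := by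
    intro i x h1 h2
    have hne : R i ≠ R (i + 1) := fun h => by
      have := Rinj h; clear * - this; revert i; decide
    exact two_vert hP (hRf i) (hRf _) hne (hR5 i) (hR5 _) (hRu1 i) (hRu (i + 1)) h1 h2
  have z2 : ∀ i : ZMod 5, i + 1 + 1 = i + 2 := by decide
  have hmw : ∀ i, w i ∈ edgeVerts (R i) := fun i => by rw [hEV]; simp
  have hmu : ∀ i, u i ∈ edgeVerts (R i) := fun i => by rw [hEV]; simp
  have hmu1 : ∀ i, u (i + 1) ∈ edgeVerts (R i) := fun i => by rw [hEV]; simp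
  have c1 : ∀ i, w i ≠ w (i + 1) := by
    intro i h
    rcases hcons i (w i) (hmw i) (h ▸ hmw (i + 1)) with h' | h'
    · exact hwv _ _ h'
    · exact (hdist i).2.2.2.2.2.2.2.2 h'
  have c2 : ∀ i, w i ≠ u (i + 2) := by
    intro i h
    rcases hcons i (w i) (hmw i) (h ▸ z2 i ▸ hmu1 (i + 1)) with h' | h'
    · exact hwv _ _ h'
    · exact (hdist i).2.2.2.2.2.2.2.2 h'
  have c3 : ∀ i, u i ≠ u (i + 2) := by
    intro i h
    rcases hcons i (u i) (hmu i) (h ▸ z2 i ▸ hmu1 (i + 1)) with h' | h'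
    · exact huv _ _ h'
    · exact (hdist i).2.2.2.2.2.2.1 h'
  have c4 : ∀ i, u i ≠ w (i + 1) := by
    intro i h
    rcases hcons i (u i) (hmu i) (h ▸ hmw (i + 1)) with h' | h'
    · exact huv _ _ h'
    · exact (hdist i).2.2.2.2.2.2.1 h'
  have c5 : ∀ i, u i ≠ u (i + 1) := fun i => (hdist i).2.2.2.2.2.2.1
  have zall : ∀ i j : ZMod 5, i ≠ j → j = i + 1 ∨ j = i + 2 ∨ i = j + 1 ∨ i = j + 2 := by decide
  have uinj : ∀ i j, i ≠ j → u i ≠ u j := by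
    intro i j hij
    rcases zall i j hij with rfl | rfl | rfl | rfl
    · exact c5 _
    · exact c3 _
    · exact (c5 _).symm
    · exact (c3 _).symm
  -- neighbourhoods of the `u i`
  have aw : ∀ i, P.graph.Adj (u i) (w i) := fun i =>
    P.adj (hRf i) (by rw [hwR i, Sym2.eq_swap]; simp)
  have aw1 : ∀ i, P.graph.Adj (u (i + 1)) (w i) := fun i => P.adj (hRf i) (by rw [hwR i]; simp)
  have av : ∀ i, P.graph.Adj (u i) (v i) := fun i => P.adj (hRf i) (by rw [hwR i]; simp)
  have hNu : ∀ i x, P.graph.Adj (u (i + 1)) x → x = v (i + 1) ∨ x = w i ∨ x = w (i + 1) := by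
    intro i x hx
    obtain ⟨t, h1, h2, h3⟩ := third hP (av (i + 1)) (aw1 i) (hwv _ _).symm
    have := (h3 _).1 (aw (i + 1))
    rcases this with h | h | h
    · exact absurd h (hwv _ _)
    · exact absurd h.symm (c1 _)
    · rw [h]; exact (h3 x).1 hx
  have c6 : ∀ i, w i ≠ u (i + 3) := by
    intro i0 h0
    have step : ∀ i, w i = u (i + 3) → w (i + 2) = u (i + 2 + 3) := by
      intro i h
      have z3 : i + 2 + 1 = i + 3 := by clear * -; revert i; decide
      have z5 : i + 2 + 3 = i := by clear * -; revert i; decide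
      have := hNu (i + 2) (u i) (by rw [z3, ← h]; exact (aw i).symm)
      rw [z5]
      rcases this with h' | h' | h'
      · exact absurd h' (huv _ _)
      · exact h'.symm
      · rw [z3] at h'
        have z6 : i + 3 + 2 = i := by clear * -; revert i; decide
        have := c2 (i + 3)
        rw [z6] at this
        exact absurd h'.symm this
    have h1 := step _ h0
    have h2 := step _ h1
    have h3 := step _ h2
    have h4 := step _ h3
    have hall : ∀ i, w i = u (i + 3) := by
      intro i
      have : i = i0 ∨ i = i0 + 2 ∨ i = i0 + 2 + 2 ∨ i = i0 + 2 + 2 + 2 ∨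
          i = i0 + 2 + 2 + 2 + 2 := by clear * -; revert i i0; decide
      rcases this with rfl | rfl | rfl | rfl | rfl <;> assumption
    obtain ⟨z, hz⟩ := exists_out hP (Finset.univ.image v ∪ Finset.univ.image u) (by
      refine lt_of_le_of_lt (Finset.card_union_le _ _) ?_
      have e1 := Finset.card_image_le (s := (Finset.univ : Finset (ZMod 5))) (f := v)
      have e2 := Finset.card_image_le (s := (Finset.univ : Finset (ZMod 5))) (f := u)
      rw [Finset.card_univ, ZMod.card] at e1 e2
      omega)
    apply hz
    have := conn_all hP {x | (∃ i, v i = x) ∨ ∃ i, u i = x} (by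
      rintro x (⟨i, rfl⟩ | ⟨i, rfl⟩) y hy
      · rcases (hN i y).1 hy with rfl | rfl | rfl
        · exact Or.inl ⟨_, rfl⟩
        · exact Or.inl ⟨_, rfl⟩
        · exact Or.inr ⟨_, rfl⟩
      · have := hNu (i + 4) y (by rw [z41]; exact hy)
        rcases this with rfl | rfl | rfl
        · exact Or.inl ⟨_, rfl⟩
        · exact Or.inr ⟨_, (hall _).symm⟩
        · exact Or.inr ⟨_, (hall _).symm⟩) (x := v 0) (Or.inl ⟨0, rfl⟩) z
    simp only [Finset.mem_union, Finset.mem_image, Finset.mem_univ, true_and]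
    exact this
  have c7 : ∀ i, w i ≠ w (i + 2) := by
    intro i h
    have a1 := (aw i).symm
    have a2 := (aw1 i).symm
    have a3 := (aw (i + 2)).symm
    have a4 := (aw1 (i + 2)).symm
    rw [← h] at a3 a4
    obtain ⟨t, h1, h2, h3⟩ := third hP a1 a2 (c5 i)
    have b3 := (h3 _).1 a3
    have b4 := (h3 _).1 a4
    have n1 : i + 2 ≠ i := by clear * -; revert i; decide
    have n2 : i + 2 ≠ i + 1 := by clear * -; revert i; decide
    have n3 : i + 2 + 1 ≠ i := by clear * -; revert i; decide
    have n4 : i + 2 + 1 ≠ i + 1 := by clear * -; revert i; decide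
    have n5 : i + 2 ≠ i + 2 + 1 := by clear * -; revert i; decide
    have q3 := (b3.resolve_left (uinj _ _ n1)).resolve_left (uinj _ _ n2)
    have q4 := (b4.resolve_left (uinj _ _ n3)).resolve_left (uinj _ _ n4)
    exact uinj _ _ n5 (q3.trans q4.symm)
  have hdisj : ∀ i x, x ∈ edgeVerts (R i) → x ∈ edgeVerts (R (i + 2)) → False := by
    intro i x h1 h2
    rw [hEV] at h1 h2
    simp only [Finset.mem_insert, Finset.mem_singleton] at h1 h2
    have z3 : i + 2 + 1 = i + 3 := by clear * -; revert i; decide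
    have n1 : i ≠ i + 2 := by clear * -; revert i; decide
    have n2 : i ≠ i + 3 := by clear * -; revert i; decide
    have n3 : i + 1 ≠ i + 2 := by clear * -; revert i; decide
    have n4 : i + 1 ≠ i + 3 := by clear * -; revert i; decide
    have m4 : u (i + 1) ≠ w (i + 2) := by have := c4 (i + 1); rwa [z2] at this
    have m5 : u i ≠ w (i + 2) := by
      have := c6 (i + 2)
      have z5 : i + 2 + 3 = i := by clear * -; revert i; decide
      rw [z5] at this; exact this.symm
    rw [z3] at h2
    rcases h1 with rfl | rfl | rfl | rfl | rfl <;> rcases h2 with h | h | h | h | h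
    · exact n1 (vinj h)
    · exact n2 (vinj h)
    · exact huv _ _ h.symm
    · exact hwv _ _ h.symm
    · exact huv _ _ h.symm
    · exact n3 (vinj h)
    · exact n4 (vinj h)
    · exact huv _ _ h.symm
    · exact hwv _ _ h.symm
    · exact huv _ _ h.symm
    · exact huv _ _ h
    · exact huv _ _ h
    · exact uinj _ _ n4 h
    · exact m4 h
    · exact uinj _ _ n3 h
    · exact hwv _ _ h
    · exact hwv _ _ h
    · exact c6 _ h
    · exact c7 _ h
    · exact c2 _ h
    · exact huv _ _ h
    · exact huv _ _ h
    · exact uinj _ _ n2 h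
    · exact m5 h
    · exact uinj _ _ n1 h
  refine ⟨R, ⟨Rinj, fun i => ⟨hRf i, hR5 i⟩, ?_⟩, fun i => ⟨hRf i, hRp i, hRne i⟩⟩
  intro i j hij
  constructor
  · rintro ⟨x, hx⟩
    rw [Finset.mem_inter] at hx
    rcases zall i j hij with h | rfl | h | rfl
    · exact Or.inl h
    · exact (hdisj _ _ hx.1 hx.2).elim
    · exact Or.inr h
    · exact (hdisj _ _ hx.2 hx.1).elim
  · rintro (rfl | rfl)
    · exact ⟨u (i + 1), Finset.mem_inter.2 ⟨hmu1 i, hmu _⟩⟩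
    · exact ⟨u (j + 1), Finset.mem_inter.2 ⟨hmu _, hmu1 j⟩⟩

/-! ### Interior edges and vertices of a set of faces -/

open Classical in
/-- Interior edges of a set of faces. -/
noncomputable def IE (P : PlaneGraph V) (X : Finset (Finset (Sym2 V))) : Finset (Sym2 V) :=
  Finset.univ.filter fun e => e ∈ P.graph.edgeSet ∧ ∀ f ∈ P.faces, e ∈ f → f ∈ X

open Classical in
/-- Interior vertices of a set of faces. -/
noncomputable def IV (P : PlaneGraph V) (X : Finset (Finset (Sym2 V))) : Finset V :=
  Finset.univ.filter fun v => ∀ f ∈ P.faces, v ∈ edgeVerts f → f ∈ X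

lemma mem_IE {P : PlaneGraph V} {X : Finset (Finset (Sym2 V))} {e : Sym2 V} :
    e ∈ IE P X ↔ e ∈ P.graph.edgeSet ∧ ∀ f ∈ P.faces, e ∈ f → f ∈ X := by
  simp [IE]

lemma mem_IV {P : PlaneGraph V} {X : Finset (Finset (Sym2 V))} {v : V} :
    v ∈ IV P X ↔ ∀ f ∈ P.faces, v ∈ edgeVerts f → f ∈ X := by
  simp [IV]

/-- The Euler characteristic of the interior of a union of faces. -/
noncomputable def chi (P : PlaneGraph V) (X : Finset (Finset (Sym2 V))) : ℤ :=
  X.card - (IE P X).card + (IV P X).card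

/-- `X` is connected through edges. -/
def Conn (X : Finset (Finset (Sym2 V))) : Prop :=
  ∀ S ⊆ X, S.Nonempty → (∀ f ∈ S, ∀ g ∈ X, (f ∩ g).Nonempty → g ∈ S) → S = X

lemma mem_ev {f : Finset (Sym2 V)} {e : Sym2 V} {v : V} (h : e ∈ f) (hv : v ∈ e) :
    v ∈ edgeVerts f := by
  obtain ⟨w, rfl⟩ := Sym2.mem_iff_exists.1 hv
  exact mem_edgeVerts.2 ⟨w, h⟩

lemma vert_struct {P : PlaneGraph V} (hP : IsFullerene P) (v : V) :
    ∃ a b c f g h, a ≠ b ∧ a ≠ c ∧ b ≠ c ∧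
      (∀ x, P.graph.Adj v x ↔ x = a ∨ x = b ∨ x = c) ∧
      f ∈ P.faces ∧ g ∈ P.faces ∧ h ∈ P.faces ∧ f ≠ g ∧ f ≠ h ∧ g ≠ h ∧
      (∀ k ∈ P.faces, s(v, a) ∈ k ↔ k = f ∨ k = h) ∧
      (∀ k ∈ P.faces, s(v, b) ∈ k ↔ k = f ∨ k = g) ∧
      (∀ k ∈ P.faces, s(v, c) ∈ k ↔ k = g ∨ k = h) ∧
      (∀ k ∈ P.faces, v ∈ edgeVerts k ↔ k = f ∨ k = g ∨ k = h) := by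
  obtain ⟨a, b, c, hab, hac, hbc, hN⟩ := nbrs hP v
  have ha := (hN a).2 (by simp)
  have hb := (hN b).2 (by simp)
  have hc := (hN c).2 (by simp)
  obtain ⟨f, hf, fa, fb⟩ := pair_face hP ha hb hab
  obtain ⟨g, hg, gb, gc⟩ := pair_face hP hb hc hbc
  obtain ⟨h, hh, hc', ha'⟩ := pair_face hP hc ha hac.symm
  have fc : s(v, c) ∉ f := fun h => by
    rcases no_three P hf fa fb h hab with h | h
    · exact hac h.symm
    · exact hbc h.symm
  have ga : s(v, a) ∉ g := fun h => by
    rcases no_three P hg gb gc h hbc with h | h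
    · exact hab h
    · exact hac h
  have hb' : s(v, b) ∉ h := fun h' => by
    rcases no_three P hh hc' ha' h' hac.symm with h | h
    · exact hbc h
    · exact hab h.symm
  have hfg : f ≠ g := fun h => fc (h ▸ gc)
  have hfh : f ≠ h := fun e => fc (e ▸ hc')
  have hgh : g ≠ h := fun e => ga (e ▸ ha')
  have two : ∀ {e : Sym2 V} {x y k : Finset (Sym2 V)}, x ∈ P.faces → y ∈ P.faces → x ≠ y →
      e ∈ x → e ∈ y → k ∈ P.faces → (e ∈ k ↔ k = x ∨ k = y) := by
    intro e x y k hx hy hxy ex ey hk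
    constructor
    · intro ek
      obtain ⟨p, q, hpq, -, -, -, -, hall⟩ := edge_two P (P.face_edges x hx _ ex)
      have r1 := hall x hx ex
      have r2 := hall y hy ey
      have r3 := hall k hk ek
      clear hall hN
      rcases r1 with rfl | rfl <;> rcases r2 with rfl | rfl <;> rcases r3 with rfl | rfl <;>
        simp_all
    · rintro (rfl | rfl) <;> assumption
  refine ⟨a, b, c, f, g, h, hab, hac, hbc, hN, hf, hg, hh, hfg, hfh, hgh,
    fun k hk => two hf hh hfh fa ha' hk, fun k hk => two hf hg hfg fb gb hk,
    fun k hk => two hg hh hgh gc hc' hk, fun k hk => ?_⟩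
  constructor
  · intro hv
    rcases face_hit hP hk hv ha hb hab with h' | h'
    · have := (two hf hh hfh fa ha' hk).1 h'; tauto
    · have := (two hf hg hfg fb gb hk).1 h'; tauto
  · rintro (rfl | rfl | rfl)
    · exact mem_edgeVerts.2 ⟨_, fa⟩
    · exact mem_edgeVerts.2 ⟨_, gb⟩
    · exact mem_edgeVerts.2 ⟨_, hc'⟩

lemma only_two (P : PlaneGraph V) {e : Sym2 V} {x y k : Finset (Sym2 V)} (hx : x ∈ P.faces)
    (hy : y ∈ P.faces) (hxy : x ≠ y) (ex : e ∈ x) (ey : e ∈ y) (hk : k ∈ P.faces) (ek : e ∈ k) :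
    k = x ∨ k = y := by
  obtain ⟨p, q, hpq, -, -, -, -, hall⟩ := edge_two P (P.face_edges x hx _ ex)
  have r1 := hall x hx ex
  have r2 := hall y hy ey
  have r3 := hall k hk ek
  clear hall
  rcases r1 with rfl | rfl <;> rcases r2 with rfl | rfl <;> rcases r3 with rfl | rfl <;>
    simp_all

lemma IE_of_IV {P : PlaneGraph V} {X : Finset (Finset (Sym2 V))} {v x : V} (hv : v ∈ IV P X)
    (hx : P.graph.Adj v x) : s(v, x) ∈ IE P X :=
  mem_IE.2 ⟨hx, fun f hf h => mem_IV.1 hv f hf (mem_edgeVerts.2 ⟨_, h⟩)⟩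

lemma IV_of_IE {P : PlaneGraph V} (hP : IsFullerene P) {X : Finset (Finset (Sym2 V))} {v x y : V}
    (hxy : x ≠ y) (h1 : s(v, x) ∈ IE P X) (h2 : s(v, y) ∈ IE P X) : v ∈ IV P X := by
  rw [mem_IE] at h1 h2
  refine mem_IV.2 fun f hf hv => ?_
  rcases face_hit hP hf hv h1.1 h2.1 hxy with h | h
  · exact h1.2 f hf h
  · exact h2.2 f hf h

lemma IE_of_share {P : PlaneGraph V} {X : Finset (Finset (Sym2 V))} (hX : X ⊆ P.faces)
    {f g : Finset (Sym2 V)} (hf : f ∈ X) (hg : g ∈ X) (hfg : f ≠ g) {e : Sym2 V} (h1 : e ∈ f)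
    (h2 : e ∈ g) : e ∈ IE P X := by
  refine mem_IE.2 ⟨P.face_edges f (hX hf) _ h1, fun k hk hek => ?_⟩
  rcases only_two P (hX hf) (hX hg) hfg h1 h2 hk hek with rfl | rfl <;> assumption

/-- The edges on the boundary of a set of faces. -/
def Bd (P : PlaneGraph V) (X : Finset (Finset (Sym2 V))) (e : Sym2 V) : Prop :=
  (∃ f ∈ X, e ∈ f) ∧ ∃ f ∈ P.faces, f ∉ X ∧ e ∈ f

lemma faces_conn {P : PlaneGraph V} (hP : IsFullerene P) {S : Finset (Finset (Sym2 V))}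
    (hS : S ⊆ P.faces) (hne : S.Nonempty)
    (hcl : ∀ f ∈ S, ∀ g ∈ P.faces, (f ∩ g).Nonempty → g ∈ S) : S = P.faces := by
  apply Finset.Subset.antisymm hS
  intro k hk
  obtain ⟨f, hf⟩ := hne
  obtain ⟨e, he⟩ := (P.fc (hS hf)).nonempty
  obtain ⟨e', he'⟩ := (P.fc hk).nonempty
  induction e with | h a b => ?_
  induction e' with | h a' b' => ?_
  have hall : ∀ v, (∃ f ∈ S, v ∈ edgeVerts f) → ∀ g ∈ P.faces, v ∈ edgeVerts g → g ∈ S := by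
    rintro v ⟨f, hf, hv⟩ g hg hvg
    obtain ⟨x, hx1, hx2⟩ := share_edge hP (hS hf) hg hv hvg
    exact hcl f hf g hg ⟨_, Finset.mem_inter.2 ⟨hx1, hx2⟩⟩
  have := conn_all hP {v | ∃ f ∈ S, v ∈ edgeVerts f} (by
    intro x hx y hxy
    obtain ⟨f, g, -, hf, -, hef, -, -⟩ := edge_two P (e := s(x, y)) hxy
    refine ⟨f, hall x hx f hf (mem_edgeVerts.2 ⟨_, hef⟩), mem_ev hef (by simp)⟩)
    (x := a) ⟨f, hf, mem_edgeVerts.2 ⟨_, he⟩⟩ a'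
  exact hall a' this k hk (mem_edgeVerts.2 ⟨_, he'⟩)

lemma bd_full {P : PlaneGraph V} (hP : IsFullerene P) {X S : Finset (Finset (Sym2 V))}
    {C : Finset (Sym2 V)} (hC : CycSet P.graph C) (hCX : ∀ e, e ∈ C ↔ Bd P X e)
    (hX : X ⊆ P.faces) (hS : S ⊆ X) (hne : S.Nonempty)
    (hcl : ∀ f ∈ S, ∀ g ∈ X, (f ∩ g).Nonempty → g ∈ S) :
    S = P.faces ∨ ∀ e ∈ C, Bd P S e := by
  classical
  have key : ∀ f ∈ S, ∀ g ∈ X, ∀ e, e ∈ f → e ∈ g → g ∈ S := fun f hf g hg e h1 h2 =>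
    hcl f hf g hg ⟨e, Finset.mem_inter.2 ⟨h1, h2⟩⟩
  have hout : ∀ e, Bd P S e → Bd P X e := by
    rintro e ⟨⟨f, hf, hef⟩, g, hg, hgS, heg⟩
    exact ⟨⟨f, hS hf, hef⟩, g, hg, fun hgX => hgS (key f hf g hgX e hef heg), heg⟩
  by_cases hemp : ∃ e, Bd P S e
  · right
    have := hC.closed (C.filter (Bd P S)) (Finset.filter_subset _ _)
      (by obtain ⟨e, he⟩ := hemp
          exact ⟨e, Finset.mem_filter.2 ⟨(hCX e).2 (hout e he), he⟩⟩) (by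
      intro x y z hxy hyz
      rw [Finset.mem_filter] at hxy ⊢
      refine ⟨hyz, ?_⟩
      obtain ⟨hxyC, hxyS⟩ := hxy
      by_cases hzx : z = x
      · subst hzx; rwa [Sym2.eq_swap]
      obtain ⟨z', hz', hz'C, hz'all⟩ := hC.other hxyC
      have hzz : z = z' := (hz'all z hyz).resolve_left hzx
      subst hzz
      have hbz : Bd P X s(y, z) := (hCX _).1 hyz
      have hadjx : P.graph.Adj y x := by
        obtain ⟨⟨f, hf, hef⟩, -⟩ := hxyS
        exact (P.adj (hX (hS hf)) hef).symm
      have hadjz : P.graph.Adj y z := by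
        obtain ⟨⟨f, hf, hef⟩, -⟩ := hbz
        exact P.adj (hX hf) hef
      obtain ⟨w, hwx, hwz, hN⟩ := third hP hadjx hadjz (Ne.symm hzx)
      have hadjw : P.graph.Adj y w := (hN w).2 (by simp)
      have hwC : s(y, w) ∉ C := fun h => by
        rcases hz'all w h with h | h <;> contradiction
      obtain ⟨f1, hf1, f1x, f1z⟩ := pair_face hP hadjx hadjz (Ne.symm hzx)
      obtain ⟨f2, hf2, f2x, f2w⟩ := pair_face hP hadjx hadjw (Ne.symm hwx)
      obtain ⟨f3, hf3, f3z, f3w⟩ := pair_face hP hadjz hadjw (Ne.symm hwz)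
      have h12 : f1 ≠ f2 := by
        rintro rfl
        rcases no_three P hf1 f1x f1z f2w (Ne.symm hzx) with h | h <;> contradiction
      have h23 : f2 ∈ X ↔ f3 ∈ X := by
        constructor
        · intro h; by_contra h'
          exact hwC ((hCX _).2 ⟨⟨f2, h, f2w⟩, f3, hf3, h', f3w⟩)
        · intro h; by_contra h'
          exact hwC ((hCX _).2 ⟨⟨f3, h, f3w⟩, f2, hf2, h', f2w⟩)
      obtain ⟨⟨p, hpS, hpe⟩, q, hq, hqS, hqe⟩ := hxyS
      rw [Sym2.eq_swap] at hpe hqe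
      have hqX : q ∉ X := fun h => hqS (key p hpS q h _ hpe hqe)
      have hpX := hS hpS
      have hp := hX hpX
      rcases only_two P hf1 hf2 h12 f1x f2x hp hpe with h | h
      · rcases only_two P hf1 hf2 h12 f1x f2x hq hqe with h' | h'
        · subst h; subst h'; exact absurd hpX hqX
        · subst h; subst h'
          refine ⟨⟨p, hpS, f1z⟩, f3, hf3, fun h => hqX (h23.2 (hS h)), f3z⟩
      · rcases only_two P hf1 hf2 h12 f1x f2x hq hqe with h' | h'
        · subst h; subst h'
          exact ⟨⟨f3, key p hpS f3 (h23.1 hpX) _ f2w f3w, f3z⟩, q, hq, hqS, f1z⟩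
        · subst h; subst h'; exact absurd hpX hqX)
    intro e he
    rw [← this, Finset.mem_filter] at he
    exact he.2
  · left
    refine faces_conn hP (hS.trans hX) hne fun f hf g hg hfg => ?_
    by_contra hgS
    obtain ⟨e, he⟩ := hfg
    rw [Finset.mem_inter] at he
    exact hemp ⟨e, ⟨f, hf, he.1⟩, g, hg, hgS, he.2⟩

lemma conn_of_cyc {P : PlaneGraph V} (hP : IsFullerene P) {X : Finset (Finset (Sym2 V))}
    {C : Finset (Sym2 V)} (hC : CycSet P.graph C) (hCX : ∀ e, e ∈ C ↔ Bd P X e)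
    (hX : X ⊆ P.faces) : Conn X := by
  intro S hS hne hcl
  rcases bd_full hP hC hCX hX hS hne hcl with h | h
  · subst h; exact Finset.Subset.antisymm hS hX
  by_contra hSX
  have hT : (X \ S).Nonempty := by
    rw [Finset.sdiff_nonempty]
    exact fun h => hSX (Finset.Subset.antisymm hS h)
  have hTcl : ∀ f ∈ X \ S, ∀ g ∈ X, (f ∩ g).Nonempty → g ∈ X \ S := by
    intro f hf g hg hfg
    rw [Finset.mem_sdiff] at hf ⊢
    refine ⟨hg, fun hgS => hf.2 (hcl g hgS f hf.1 ?_)⟩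
    rwa [Finset.inter_comm]
  rcases bd_full hP hC hCX hX Finset.sdiff_subset hT hTcl with h' | h'
  · obtain ⟨f, hf⟩ := hne
    have : f ∈ X \ S := by rw [h']; exact hX (hS hf)
    exact (Finset.mem_sdiff.1 this).2 hf
  · obtain ⟨e, he⟩ := hC.nonempty
    obtain ⟨⟨f, hf, hef⟩, -⟩ := h e he
    obtain ⟨⟨g, hg, heg⟩, -⟩ := h' e he
    obtain ⟨-, k, hk, hkX, hek⟩ := (hCX e).1 he
    rw [Finset.mem_sdiff] at hg
    have hfg : f ≠ g := fun h => hg.2 (h ▸ hf)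
    rcases only_two P (hX (hS hf)) (hX hg.1) hfg hef heg hk hek with rfl | rfl
    · exact hkX (hS hf)
    · exact hkX hg.1

/-! ### The Euler characteristic of a connected set of faces is at most one -/

lemma rank_ineq {F E T : Type} [Fintype F] [Fintype E] [Fintype T] [DecidableEq F]
    [DecidableEq E] [DecidableEq T] (D : Matrix E F (ZMod 2)) (N : Matrix T E (ZMod 2))
    (hND : N * D = 0) (hN : ∀ g : T → ZMod 2, Matrix.vecMul g N = 0 → g = 0)
    (hD : ∀ h : F → ZMod 2, Matrix.mulVec D h = 0 → h = 0 ∨ h = 1) :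
    Fintype.card F + Fintype.card T ≤ Fintype.card E + 1 := by
  have h1 := Matrix.rank_add_rank_le_card_of_mul_eq_zero hND
  have h2 : N.rank = Fintype.card T := by
    rw [← Matrix.rank_transpose]
    have hinj : Function.Injective N.transpose.mulVecLin := by
      rw [← LinearMap.ker_eq_bot, LinearMap.ker_eq_bot']
      intro g hg
      apply hN
      rw [Matrix.mulVecLin_apply, Matrix.mulVec_transpose] at hg
      exact hg
    have := LinearMap.finrank_range_of_inj hinj
    rw [Matrix.rank, this]; simp
  have h3 := LinearMap.finrank_range_add_finrank_ker D.mulVecLin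
  have h4 : Module.finrank (ZMod 2) (LinearMap.ker D.mulVecLin) ≤ 1 := by
    have hle : LinearMap.ker D.mulVecLin ≤ Submodule.span (ZMod 2) {(1 : F → ZMod 2)} := by
      intro h hh
      rw [LinearMap.mem_ker, Matrix.mulVecLin_apply] at hh
      rcases hD h hh with rfl | rfl
      · exact Submodule.zero_mem _
      · exact Submodule.mem_span_singleton_self _
    refine (Submodule.finrank_mono hle).trans ?_
    have := finrank_span_le_card (R := ZMod 2) ({(1 : F → ZMod 2)} : Set (F → ZMod 2))
    simpa using this
  rw [Module.finrank_fintype_fun_eq_card] at h3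
  rw [Matrix.rank] at h1 h2
  rw [Matrix.rank] at h1
  omega

lemma edges_at {P : PlaneGraph V} {f : Finset (Sym2 V)} (hf : f ∈ P.faces)
    (v : V) : (f.filter fun e => v ∈ e).card = 0 ∨ (f.filter fun e => v ∈ e).card = 2 := by
  by_cases hv : v ∈ edgeVerts f
  · right
    obtain ⟨x, hx⟩ := mem_edgeVerts.1 hv
    obtain ⟨y, hy, hyf⟩ := face_next P hf hx
    have : (f.filter fun e => v ∈ e) = {s(v, x), s(v, y)} := by
      ext e
      simp only [Finset.mem_filter, Finset.mem_insert, Finset.mem_singleton]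
      constructor
      · rintro ⟨he, hve⟩
        obtain ⟨w, rfl⟩ := Sym2.mem_iff_exists.1 hve
        rcases no_three P hf hx hyf he hy.symm with rfl | rfl
        · exact Or.inl rfl
        · exact Or.inr rfl
      · rintro (rfl | rfl)
        · exact ⟨hx, by simp⟩
        · exact ⟨hyf, by simp⟩
    rw [this, Finset.card_pair]
    intro h
    exact hy (Sym2.congr_right.1 h).symm
  · left
    rw [Finset.card_eq_zero, Finset.filter_eq_empty_iff]
    intro e he hve
    exact hv (mem_ev he hve)

lemma z2_ne_zero {a b : ZMod 2} (h : a + b = 0) : a = b := by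
  revert a b; decide

lemma conn_chi {P : PlaneGraph V} (hP : IsFullerene P) {X : Finset (Finset (Sym2 V))}
    (hX : X ⊆ P.faces) (hX' : X ≠ P.faces) (hc : Conn X) : chi P X ≤ 1 := by
  classical
  have := rank_ineq (F := {f // f ∈ X}) (E := {e // e ∈ IE P X}) (T := {v // v ∈ IV P X})
    (Matrix.of fun e f => if e.1 ∈ f.1 then 1 else 0)
    (Matrix.of fun v e => if v.1 ∈ e.1 then 1 else 0) ?_ ?_ ?_
  · simp only [Fintype.card_coe] at this
    unfold chi
    omega
  · ext v f
    rw [Matrix.mul_apply, Matrix.zero_apply]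
    simp only [Matrix.of_apply]
    have h1 : ∀ e : {e // e ∈ IE P X}, (if v.1 ∈ e.1 then (1 : ZMod 2) else 0) *
        (if e.1 ∈ f.1 then 1 else 0) = if (v.1 ∈ e.1 ∧ e.1 ∈ f.1) then 1 else 0 := by
      intro e; split_ifs <;> simp_all
    rw [Finset.sum_congr rfl fun e _ => h1 e]
    rw [Finset.sum_coe_sort (IE P X) fun e => if (v.1 ∈ e ∧ e ∈ f.1) then (1 : ZMod 2) else 0]
    rw [Finset.sum_boole]
    have h2 : ((IE P X).filter fun e => v.1 ∈ e ∧ e ∈ f.1) = f.1.filter fun e => v.1 ∈ e := by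
      ext e
      simp only [Finset.mem_filter]
      constructor
      · rintro ⟨-, h1, h2⟩; exact ⟨h2, h1⟩
      · rintro ⟨h1, h2⟩
        refine ⟨mem_IE.2 ⟨P.face_edges _ (hX f.2) _ h1, fun g hg heg => ?_⟩, h2, h1⟩
        exact mem_IV.1 v.2 g hg (mem_ev heg h2)
    rw [h2]
    rcases edges_at (hX f.2) v.1 with h | h <;> rw [h]
    · rfl
    · rfl
  · intro g hg
    by_contra hg0
    obtain ⟨x, hx⟩ := Function.ne_iff.1 hg0
    let G : V → ZMod 2 := fun v => if h : v ∈ IV P X then g ⟨v, h⟩ else 0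
    have hGx : G x.1 ≠ 0 := by simpa [G] using hx
    have hGIV : ∀ v, G v ≠ 0 → v ∈ IV P X := by
      intro v hv; by_contra h; exact hv (by simp [G, h])
    have hedge : ∀ a b, a ≠ b → s(a, b) ∈ IE P X → G a + G b = 0 := by
      intro a b hab he
      have h1 := congrFun hg ⟨s(a, b), he⟩
      simp only [Matrix.vecMul, dotProduct, Pi.zero_apply, Matrix.of_apply] at h1
      have h2 : ∀ v : {v // v ∈ IV P X}, g v * (if v.1 ∈ s(a, b) then 1 else 0)
          = if v.1 ∈ s(a, b) then G v.1 else 0 := by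
        intro v; simp [G]
      rw [Finset.sum_congr rfl fun v _ => h2 v] at h1
      rw [Finset.sum_coe_sort (IV P X) fun v => if v ∈ s(a, b) then G v else 0] at h1
      rw [← h1]
      rw [Finset.sum_subset (Finset.subset_univ (IV P X)) (by
        intro v _ hv
        have : G v = 0 := by by_contra h; exact hv (hGIV v h)
        simp [this])]
      rw [← Finset.sum_filter]
      have : (Finset.univ.filter fun v => v ∈ s(a, b)) = {a, b} := by ext v; simp
      rw [this, Finset.sum_pair hab]
    have hall := conn_all hP {v | G v ≠ 0} (by
      intro v hv y hvy
      have he := IE_of_IV (hGIV v hv) hvy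
      have := z2_ne_zero (hedge v y hvy.ne he)
      have hv' : G v ≠ 0 := hv
      show G y ≠ 0
      rwa [← this]) (x := x.1) hGx
    apply hX'
    refine Finset.Subset.antisymm hX fun f hf => ?_
    obtain ⟨e, he⟩ := (P.fc hf).nonempty
    induction e with | h a b => ?_
    exact mem_IV.1 (hGIV a (hall a)) f hf (mem_edgeVerts.2 ⟨_, he⟩)
  · intro h hh
    by_cases hne : h = 0
    · exact Or.inl hne
    right
    obtain ⟨x, hx⟩ := Function.ne_iff.1 hne
    have hx : h x ≠ 0 := hx
    have hedge : ∀ f g : {f // f ∈ X}, (f.1 ∩ g.1).Nonempty → h f = h g := by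
      rintro f g ⟨e, he⟩
      by_cases hfg : f = g
      · rw [hfg]
      rw [Finset.mem_inter] at he
      have hfg' : f.1 ≠ g.1 := fun h => hfg (Subtype.ext h)
      have heI := IE_of_share hX f.2 g.2 hfg' he.1 he.2
      have h1 := congrFun hh ⟨e, heI⟩
      simp only [Matrix.mulVec, dotProduct, Pi.zero_apply, Matrix.of_apply] at h1
      apply z2_ne_zero
      rw [← h1]
      have h2 : ∀ k : {f // f ∈ X}, (if e ∈ k.1 then (1 : ZMod 2) else 0) * h k
          = if (k = f ∨ k = g) then h k else 0 := by
        intro k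
        have : e ∈ k.1 ↔ (k = f ∨ k = g) := by
          constructor
          · intro hk
            exact (only_two P (hX f.2) (hX g.2) hfg' he.1 he.2 (hX k.2) hk).imp
              (fun h => Subtype.ext h) (fun h => Subtype.ext h)
          · rintro (rfl | rfl)
            · exact he.1
            · exact he.2
        simp [this]
      rw [Finset.sum_congr rfl fun k _ => h2 k, ← Finset.sum_filter]
      have : (Finset.univ.filter fun k => k = f ∨ k = g) = {f, g} := by ext v; simp
      rw [this, Finset.sum_pair hfg]
    have hS := hc (X.filter fun f => ∃ hf : f ∈ X, h ⟨f, hf⟩ = h x) (Finset.filter_subset _ _)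
      ⟨x.1, Finset.mem_filter.2 ⟨x.2, x.2, rfl⟩⟩ (by
        intro f hf g hg hfg
        rw [Finset.mem_filter] at hf ⊢
        obtain ⟨hf, hf', hfx⟩ := hf
        exact ⟨hg, hg, by rw [← hfx]; exact (hedge ⟨f, hf⟩ ⟨g, hg⟩ hfg).symm⟩)
    have hx1 : h x = 1 := by
      generalize h x = t at hx
      clear * - hx
      revert t; decide
    refine funext fun f => ?_
    have hfm : f.1 ∈ X.filter fun f => ∃ hf : f ∈ X, h ⟨f, hf⟩ = h x :=
      Eq.mpr (congrArg (fun A => f.1 ∈ A) hS) f.2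
    rw [Finset.mem_filter] at hfm
    obtain ⟨-, hf', hfx⟩ := hfm
    rw [Pi.one_apply, ← hx1]
    exact hfx

/-! ### Euler characteristics of complementary sets of faces -/

open Classical in
/-- All edges. -/
noncomputable def AE (P : PlaneGraph V) : Finset (Sym2 V) :=
  Finset.univ.filter fun e => e ∈ P.graph.edgeSet

lemma mem_AE {P : PlaneGraph V} {e : Sym2 V} : e ∈ AE P ↔ e ∈ P.graph.edgeSet := by
  simp [AE]

lemma sum_faces (P : PlaneGraph V) : ∑ f ∈ P.faces, f.card = 2 * (AE P).card := by
  have h1 : ∀ f ∈ P.faces, f.card = ((AE P).filter fun e => e ∈ f).card := by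
    intro f hf
    congr 1
    ext e
    simp only [Finset.mem_filter, mem_AE]
    exact ⟨fun h => ⟨P.face_edges f hf e h, h⟩, fun h => h.2⟩
  rw [Finset.sum_congr rfl h1]
  have := Finset.sum_card_bipartiteAbove_eq_sum_card_bipartiteBelow
    (s := P.faces) (t := AE P) (fun f e => e ∈ f)
  unfold Finset.bipartiteAbove Finset.bipartiteBelow at this
  rw [this, Finset.sum_congr rfl fun e he => P.edge_faces e (mem_AE.1 he)]
  simp [mul_comm]

lemma chi_compl {P : PlaneGraph V} (hP : IsFullerene P) {X : Finset (Finset (Sym2 V))}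
    (hX : X ⊆ P.faces) : chi P X + chi P (P.faces \ X) = 2 := by
  classical
  set Y := P.faces \ X with hY
  have hYm : ∀ f ∈ P.faces, f ∈ Y ↔ f ∉ X := fun f hf => by simp [hY, hf]
  have hcard : X.card + Y.card = P.faces.card := by
    rw [hY, Finset.card_sdiff_of_subset hX]
    have := Finset.card_le_card hX
    omega
  let ME : Finset (Sym2 V) := (AE P).filter fun e => e ∉ IE P X ∧ e ∉ IE P Y
  let MV : Finset V := Finset.univ.filter fun v => v ∉ IV P X ∧ v ∉ IV P Y
  have hE : (IE P X).card + (IE P Y).card + ME.card = (AE P).card := by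
    have hd : Disjoint (IE P X) (IE P Y) := by
      rw [Finset.disjoint_left]
      intro e h1 h2
      rw [mem_IE] at h1 h2
      obtain ⟨f, g, -, hf, -, hef, -, -⟩ := edge_two P h1.1
      exact (hYm f hf).1 (h2.2 f hf hef) (h1.2 f hf hef)
    rw [← Finset.card_union_of_disjoint hd, ← Finset.card_union_of_disjoint]
    · congr 1
      ext e
      simp only [ME, Finset.mem_union, Finset.mem_filter, mem_AE]
      constructor
      · rintro ((h | h) | h)
        · exact (mem_IE.1 h).1
        · exact (mem_IE.1 h).1
        · exact h.1
      · intro h; clear * - h; tauto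
    · rw [Finset.disjoint_left]
      intro e h1 h2
      simp only [ME, Finset.mem_union, Finset.mem_filter] at h1 h2
      tauto
  have hV : (IV P X).card + (IV P Y).card + MV.card = Fintype.card V := by
    have hd : Disjoint (IV P X) (IV P Y) := by
      rw [Finset.disjoint_left]
      intro v h1 h2
      rw [mem_IV] at h1 h2
      obtain ⟨a, b, c, f, g, h, -, -, -, -, hf, -, -, -, -, -, -, -, -, hv⟩ := vert_struct hP v
      have hvf := (hv f hf).2 (Or.inl rfl)
      exact (hYm f hf).1 (h2 f hf hvf) (h1 f hf hvf)
    rw [← Finset.card_union_of_disjoint hd, ← Finset.card_union_of_disjoint, ← Finset.card_univ]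
    · congr 1
      ext v
      simp only [MV, Finset.mem_union, Finset.mem_filter, Finset.mem_univ, true_and, iff_true]
      tauto
    · rw [Finset.disjoint_left]
      intro e h1 h2
      simp only [MV, Finset.mem_union, Finset.mem_filter] at h1 h2
      tauto
  have hcount : ∀ v, (ME.filter fun e => v ∈ e).card = if v ∈ MV then 2 else 0 := by
    intro v
    obtain ⟨a, b, c, f, g, h, hab, hac, hbc, hN, hf, hg, hh, hfg, hfh, hgh, ha, hb, hc, hv⟩ :=
      vert_struct hP v
    have IEiff : ∀ Z x (k l : Finset (Sym2 V)), k ∈ P.faces → l ∈ P.faces → P.graph.Adj v x →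
        (∀ m ∈ P.faces, s(v, x) ∈ m ↔ m = k ∨ m = l) →
        (s(v, x) ∈ IE P Z ↔ k ∈ Z ∧ l ∈ Z) := by
      intro Z x k l hk hl hx hm
      rw [mem_IE]
      constructor
      · rintro ⟨-, h⟩
        exact ⟨h k hk ((hm k hk).2 (Or.inl rfl)), h l hl ((hm l hl).2 (Or.inr rfl))⟩
      · rintro ⟨h1, h2⟩
        refine ⟨hx, fun m hm' hxm => ?_⟩
        rcases (hm m hm').1 hxm with rfl | rfl <;> assumption
    have IViff : ∀ Z, v ∈ IV P Z ↔ f ∈ Z ∧ g ∈ Z ∧ h ∈ Z := by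
      intro Z
      rw [mem_IV]
      constructor
      · intro H
        exact ⟨H f hf ((hv f hf).2 (by simp)), H g hg ((hv g hg).2 (by simp)),
          H h hh ((hv h hh).2 (by simp))⟩
      · rintro ⟨h1, h2, h3⟩ k hk hvk
        rcases (hv k hk).1 hvk with rfl | rfl | rfl <;> assumption
    have aa := (hN a).2 (by simp)
    have ab := (hN b).2 (by simp)
    have ac := (hN c).2 (by simp)
    have MEiff : ∀ x (k l : Finset (Sym2 V)), k ∈ P.faces → l ∈ P.faces → P.graph.Adj v x →
        (∀ m ∈ P.faces, s(v, x) ∈ m ↔ m = k ∨ m = l) →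
        (s(v, x) ∈ ME ↔ ¬ (k ∈ X ↔ l ∈ X)) := by
      intro x k l hk hl hx hm
      simp only [ME, Finset.mem_filter, mem_AE, IEiff _ x k l hk hl hx hm, hYm k hk, hYm l hl,
        SimpleGraph.mem_edgeSet]
      clear * - hx
      tauto
    have Ma := MEiff a f h hf hh aa ha
    have Mb := MEiff b f g hf hg ab hb
    have Mc := MEiff c g h hg hh ac hc
    have MVm : v ∈ MV ↔ ¬ ((f ∈ X ↔ g ∈ X) ∧ (g ∈ X ↔ h ∈ X)) := by
      simp only [MV, Finset.mem_filter, Finset.mem_univ, true_and, IViff, hYm f hf, hYm g hg,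
        hYm h hh]
      clear * -
      tauto
    have hnab : s(v, a) ≠ s(v, b) := fun h => hab (Sym2.congr_right.1 h)
    have hnac : s(v, a) ≠ s(v, c) := fun h => hac (Sym2.congr_right.1 h)
    have hnbc : s(v, b) ≠ s(v, c) := fun h => hbc (Sym2.congr_right.1 h)
    have hset : (ME.filter fun e => v ∈ e) =
        ({s(v, a), s(v, b), s(v, c)} : Finset (Sym2 V)).filter fun e => e ∈ ME := by
      ext e
      simp only [Finset.mem_filter, Finset.mem_insert, Finset.mem_singleton]
      constructor
      · rintro ⟨he, hve⟩
        obtain ⟨w, rfl⟩ := Sym2.mem_iff_exists.1 hve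
        refine ⟨?_, he⟩
        have hadj : P.graph.Adj v w := by
          simp only [ME, Finset.mem_filter, mem_AE] at he
          exact he.1
        rcases (hN w).1 hadj with rfl | rfl | rfl <;> simp
      · rintro ⟨h, he⟩
        refine ⟨he, ?_⟩
        rcases h with rfl | rfl | rfl <;> simp
    rw [hset, Finset.filter_insert, Finset.filter_insert, Finset.filter_singleton]
    simp only [Ma, Mb, Mc, MVm]
    clear * - hnab hnac hnbc
    by_cases h1 : f ∈ X <;> by_cases h2 : g ∈ X <;> by_cases h3 : h ∈ X <;>
      simp [h1, h2, h3, hnab, hnac, hnbc]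
  have hmix : MV.card = ME.card := by
    have h1 := Finset.sum_card_bipartiteAbove_eq_sum_card_bipartiteBelow
      (s := (Finset.univ : Finset V)) (t := ME) (fun v e => v ∈ e)
    unfold Finset.bipartiteAbove Finset.bipartiteBelow at h1
    rw [Finset.sum_congr rfl fun v _ => hcount v] at h1
    have h2 : ∀ e ∈ ME, ((Finset.univ : Finset V).filter fun v => v ∈ e).card = 2 := by
      intro e he
      simp only [ME, Finset.mem_filter, mem_AE] at he
      have he' := he.1
      clear he
      induction e with | h a b => ?_
      have hne : a ≠ b := SimpleGraph.Adj.ne he'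
      have : (Finset.univ.filter fun v => v ∈ s(a, b)) = {a, b} := by ext v; simp
      rw [this, Finset.card_pair hne]
    rw [Finset.sum_congr rfl h2] at h1
    simp at h1
    omega
  have h1 := sum_faces P
  have h2 := P.euler
  unfold chi
  omega

lemma bd_compl {P : PlaneGraph V} {X : Finset (Finset (Sym2 V))}
    (hX : X ⊆ P.faces) (e : Sym2 V) : Bd P (P.faces \ X) e ↔ Bd P X e := by
  constructor
  · rintro ⟨⟨f, hf, hef⟩, g, hg, hgX, heg⟩
    rw [Finset.mem_sdiff] at hf hgX
    refine ⟨⟨g, ?_, heg⟩, f, hf.1, hf.2, hef⟩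
    by_contra h; exact hgX ⟨hg, h⟩
  · rintro ⟨⟨f, hf, hef⟩, g, hg, hgX, heg⟩
    refine ⟨⟨g, Finset.mem_sdiff.2 ⟨hg, hgX⟩, heg⟩, f, hX hf, fun h => ?_, hef⟩
    exact (Finset.mem_sdiff.1 h).2 hf

lemma frag_cyc {P : PlaneGraph V} (B : Fragment P) :
    ∃ C, CycSet P.graph C ∧ ∀ e, e ∈ C ↔ Bd P B.inFaces e := by
  obtain ⟨v, c, hc, hce⟩ := B.boundary_cycle
  refine ⟨c.edges.toFinset, ⟨v, c, hc, rfl⟩, fun e => ?_⟩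
  rw [hce, Finset.mem_filter, Finset.card_eq_one]
  constructor
  · rintro ⟨-, f, hf⟩
    have hm : ∀ k, (k ∈ B.inFaces ∧ e ∈ k) ↔ k = f := by
      intro k
      have : k ∈ B.inFaces.filter (fun f => e ∈ f) ↔ k = f := by rw [hf]; simp
      rwa [Finset.mem_filter] at this
    obtain ⟨h1, h2⟩ := (hm f).2 rfl
    refine ⟨⟨f, h1, h2⟩, ?_⟩
    obtain ⟨x, y, hxy, hx, hy, hex, hey, hall⟩ :=
      edge_two P (P.face_edges f (B.subFaces h1) _ h2)
    by_cases hxB : x ∈ B.inFaces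
    · refine ⟨y, hy, fun hyB => ?_, hey⟩
      exact hxy (((hm x).1 ⟨hxB, hex⟩).trans ((hm y).1 ⟨hyB, hey⟩).symm)
    · exact ⟨x, hx, hxB, hex⟩
  · rintro ⟨⟨f, hf, hef⟩, g, hg, hgB, heg⟩
    refine ⟨Finset.mem_sup.2 ⟨f, hf, hef⟩, f, ?_⟩
    have hfg : f ≠ g := fun h => hgB (h ▸ hf)
    ext k
    simp only [Finset.mem_filter, Finset.mem_singleton]
    constructor
    · rintro ⟨hk, hek⟩
      rcases only_two P (B.subFaces hf) hg hfg hef heg (B.subFaces hk) hek with h | h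
      · exact h
      · exact absurd (h ▸ hk) hgB
    · rintro rfl; exact ⟨hf, hef⟩

lemma frag_conn {P : PlaneGraph V} (hP : IsFullerene P) (B : Fragment P) : Conn B.inFaces := by
  obtain ⟨C, hC, h⟩ := frag_cyc B
  exact conn_of_cyc hP hC h B.subFaces

lemma frag_chi {P : PlaneGraph V} (hP : IsFullerene P) (B : Fragment P) :
    1 ≤ chi P B.inFaces := by
  obtain ⟨C, hC, h⟩ := frag_cyc B
  have hc : Conn (P.faces \ B.inFaces) := conn_of_cyc hP hC
    (fun e => (h e).trans (bd_compl B.subFaces e).symm) Finset.sdiff_subset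
  have hne : P.faces \ B.inFaces ≠ P.faces := by
    intro h
    obtain ⟨f, hf⟩ := B.nonempty
    have := B.subFaces hf
    rw [← h, Finset.mem_sdiff] at this
    exact this.2 hf
  have h1 := conn_chi hP Finset.sdiff_subset hne hc
  have h2 := chi_compl hP B.subFaces
  omega

lemma frag_ne {P : PlaneGraph V} (B : Fragment P) : B.inFaces ≠ P.faces := by
  obtain ⟨C, hC, h⟩ := frag_cyc B
  obtain ⟨e, he⟩ := hC.nonempty
  obtain ⟨-, g, hg, hgB, -⟩ := (h e).1 he
  exact fun h => hgB (h ▸ hg)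

/-! ### A discharging argument -/

open Classical in
/-- The share of the interior vertex `v` given to the face `p`. -/
noncomputable def share (P : PlaneGraph V) (X : Finset (Finset (Sym2 V))) (p : Finset (Sym2 V))
    (v : V) : ℤ :=
  if ∀ x y, s(v, x) ∈ p → s(v, y) ∈ p → (x ∈ IV P X ↔ y ∈ IV P X) then 2 else 1

/-- The weight of a face. -/
noncomputable def weight (P : PlaneGraph V) (X : Finset (Finset (Sym2 V)))
    (p : Finset (Sym2 V)) : ℤ :=
  4 - 2 * ((p ∩ IE P X).card : ℤ) + ∑ v ∈ edgeVerts p ∩ IV P X, share P X p v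

open Classical in
lemma share_eq {P : PlaneGraph V} {X : Finset (Finset (Sym2 V))} {p : Finset (Sym2 V)}
    (hp : p ∈ P.faces) {v a b : V} (hab : a ≠ b) (ha : s(v, a) ∈ p) (hb : s(v, b) ∈ p) :
    share P X p v = if (a ∈ IV P X ↔ b ∈ IV P X) then 2 else 1 := by
  unfold share
  congr 1
  apply propext
  constructor
  · intro h; exact h a b ha hb
  · intro h x y hx hy
    rcases no_three P hp ha hb hx hab with rfl | rfl <;>
      rcases no_three P hp ha hb hy hab with rfl | rfl <;> tauto

lemma share_sum {P : PlaneGraph V} (hP : IsFullerene P) {X : Finset (Finset (Sym2 V))}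
    {v : V} (hv : v ∈ IV P X) (hX : X ⊆ P.faces) :
    4 ≤ ∑ p ∈ X.filter (fun p => v ∈ edgeVerts p), share P X p v := by
  classical
  obtain ⟨a, b, c, f, g, h, hab, hac, hbc, hN, hf, hg, hh, hfg, hfh, hgh, ha, hb, hc, hvk⟩ :=
    vert_struct hP v
  have hset : X.filter (fun p => v ∈ edgeVerts p) = {f, g, h} := by
    ext k
    simp only [Finset.mem_filter, Finset.mem_insert, Finset.mem_singleton]
    constructor
    · rintro ⟨h1, h2⟩; exact (hvk k (hX h1)).1 h2
    · intro hk
      have hkf : k ∈ P.faces := by rcases hk with rfl | rfl | rfl <;> assumption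
      have := (hvk k hkf).2 hk
      exact ⟨mem_IV.1 hv k hkf this, this⟩
  rw [hset, Finset.sum_insert (by simp [hfg, hfh]), Finset.sum_pair hgh]
  rw [share_eq hf hab ((ha f hf).2 (by simp)) ((hb f hf).2 (by simp)),
    share_eq hg hbc ((hb g hg).2 (by simp)) ((hc g hg).2 (by simp)),
    share_eq hh hac ((ha h hh).2 (by simp)) ((hc h hh).2 (by simp))]
  by_cases h1 : a ∈ IV P X <;> by_cases h2 : b ∈ IV P X <;> by_cases h3 : c ∈ IV P X <;>
    simp [h1, h2, h3]

lemma weight_sum {P : PlaneGraph V} (hP : IsFullerene P) {X : Finset (Finset (Sym2 V))}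
    (hX : X ⊆ P.faces) : 4 * chi P X ≤ ∑ p ∈ X, weight P X p := by
  have h1 : ∑ p ∈ X, (p ∩ IE P X).card = 2 * (IE P X).card := by
    have e1 : ∀ p ∈ X, (p ∩ IE P X).card = ((IE P X).filter fun e => e ∈ p).card := by
      intro p _
      congr 1
      ext e
      simp [and_comm]
    rw [Finset.sum_congr rfl e1]
    have e2 := Finset.sum_card_bipartiteAbove_eq_sum_card_bipartiteBelow
      (s := X) (t := IE P X) (fun f e => e ∈ f)
    unfold Finset.bipartiteAbove Finset.bipartiteBelow at e2
    rw [e2]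
    have e3 : ∀ e ∈ IE P X, (X.filter fun f => e ∈ f).card = 2 := by
      intro e he
      rw [mem_IE] at he
      rw [← P.edge_faces e he.1]
      congr 1
      ext f
      simp only [Finset.mem_filter]
      exact ⟨fun h => ⟨hX h.1, h.2⟩, fun h => ⟨he.2 f h.1 h.2, h.2⟩⟩
    rw [Finset.sum_congr rfl e3]
    simp [mul_comm]
  have h2 : 4 * ((IV P X).card : ℤ) ≤ ∑ p ∈ X, ∑ v ∈ edgeVerts p ∩ IV P X, share P X p v := by
    have e1 : ∑ p ∈ X, ∑ v ∈ edgeVerts p ∩ IV P X, share P X p v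
        = ∑ v ∈ IV P X, ∑ p ∈ X.filter (fun p => v ∈ edgeVerts p), share P X p v := by
      apply Finset.sum_comm'
      intro p v
      simp only [Finset.mem_inter, Finset.mem_filter]
      tauto
    rw [e1]
    have := Finset.sum_le_sum (s := IV P X) (f := fun _ => (4 : ℤ)) fun v hv => share_sum hP hv hX
    simp only [Finset.sum_const, nsmul_eq_mul] at this
    linarith
  unfold weight chi
  rw [Finset.sum_add_distrib, Finset.sum_sub_distrib, ← Finset.mul_sum, ← Nat.cast_sum, h1]
  simp only [Finset.sum_const, nsmul_eq_mul]
  push_cast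
  linarith

lemma weight_pent {P : PlaneGraph V} (hP : IsFullerene P) {X : Finset (Finset (Sym2 V))}
    {p : Finset (Sym2 V)} (hp : p ∈ P.faces) (p5 : p.card = 5) :
    (∀ e ∈ p, e ∈ IE P X) ∨ ((1 ≤ (p ∩ IE P X).card → weight P X p ≤ 2) ∧
      (3 ≤ (p ∩ IE P X).card → weight P X p ≤ 0) ∧
      ((p ∩ IE P X).card = 2 → (∀ v ∈ edgeVerts p, v ∉ IV P X) → weight P X p ≤ 0)) := by
  classical
  obtain ⟨e0, he0⟩ := (P.fc hp).nonempty
  induction e0 with | h a b => ?_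
  obtain ⟨c, d, e, hab, hac, had, hae, hbc, hbd, hbe, hcd, hce, hde, hfe⟩ := pent_param P hp p5 he0
  have m1 : s(a, b) ∈ p := he0
  have m2 : s(b, c) ∈ p := by rw [hfe]; simp
  have m3 : s(c, d) ∈ p := by rw [hfe]; simp
  have m4 : s(d, e) ∈ p := by rw [hfe]; simp
  have m5 : s(e, a) ∈ p := by rw [hfe]; simp
  have n1 : s(b, a) ∈ p := by rw [Sym2.eq_swap]; exact m1
  have n2 : s(c, b) ∈ p := by rw [Sym2.eq_swap]; exact m2
  have n3 : s(d, c) ∈ p := by rw [Sym2.eq_swap]; exact m3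
  have n4 : s(e, d) ∈ p := by rw [Sym2.eq_swap]; exact m4
  have n5 : s(a, e) ∈ p := by rw [Sym2.eq_swap]; exact m5
  have key : ∀ x y z, x ≠ z → s(x, y) ∈ p → s(y, z) ∈ p →
      (y ∈ IV P X ↔ s(x, y) ∈ IE P X ∧ s(y, z) ∈ IE P X) := by
    intro x y z hxz h1 h2
    constructor
    · intro hy
      refine ⟨?_, IE_of_IV hy (P.adj hp h2)⟩
      have := IE_of_IV hy (P.adj hp h1).symm
      rwa [Sym2.eq_swap] at this
    · rintro ⟨h3, h4⟩
      rw [Sym2.eq_swap] at h3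
      exact IV_of_IE hP hxz h3 h4
  have Va := key e a b hbe.symm m5 m1
  have Vb := key a b c hac m1 m2
  have Vc := key b c d hbd m2 m3
  have Vd := key c d e hce m3 m4
  have Ve := key d e a had.symm m4 m5
  have Sa := share_eq (X := X) hp hbe.symm n5 m1
  have Sb := share_eq (X := X) hp hac n1 m2
  have Sc := share_eq (X := X) hp hbd n2 m3
  have Sd := share_eq (X := X) hp hce n3 m4
  have Se := share_eq (X := X) hp had.symm n4 m5
  have hEV : edgeVerts p = {a, b, c, d, e} := by rw [hfe, edgeVerts_pent]
  have hall : (∀ e ∈ p, e ∈ IE P X) ↔ (s(a, b) ∈ IE P X ∧ s(b, c) ∈ IE P X ∧ s(c, d) ∈ IE P X ∧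
      s(d, e) ∈ IE P X ∧ s(e, a) ∈ IE P X) := by
    conv_lhs => rw [hfe]
    simp
  have hcard : (p ∩ IE P X).card = (if s(a, b) ∈ IE P X then 1 else 0) +
      ((if s(b, c) ∈ IE P X then 1 else 0) + ((if s(c, d) ∈ IE P X then 1 else 0) +
      ((if s(d, e) ∈ IE P X then 1 else 0) + (if s(e, a) ∈ IE P X then 1 else 0)))) := by
    rw [← Finset.filter_mem_eq_inter, Finset.card_filter, hfe]
    rw [Finset.sum_insert (by simp [*, Ne.symm hab, Ne.symm hae, Ne.symm hac, Ne.symm had]),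
      Finset.sum_insert (by simp [*, Ne.symm hab, Ne.symm hae, Ne.symm hbc, Ne.symm hbd]),
      Finset.sum_insert (by simp [*, Ne.symm hac, Ne.symm had, Ne.symm hcd, Ne.symm hce]),
      Finset.sum_pair (by simp [*, Ne.symm hae, Ne.symm had, Ne.symm hde])]
  have hsum : ∑ v ∈ edgeVerts p ∩ IV P X, share P X p v =
      (if a ∈ IV P X then share P X p a else 0) + ((if b ∈ IV P X then share P X p b else 0) +
      ((if c ∈ IV P X then share P X p c else 0) + ((if d ∈ IV P X then share P X p d else 0) +
      (if e ∈ IV P X then share P X p e else 0)))) := by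
    rw [← Finset.filter_mem_eq_inter, Finset.sum_filter, hEV,
      Finset.sum_insert (by simp [*]), Finset.sum_insert (by simp [*]),
      Finset.sum_insert (by simp [*]), Finset.sum_pair hde]
  have hnone : (∀ v ∈ edgeVerts p, v ∉ IV P X) ↔ (a ∉ IV P X ∧ b ∉ IV P X ∧ c ∉ IV P X ∧
      d ∉ IV P X ∧ e ∉ IV P X) := by
    rw [hEV]; simp
  rw [hall, hnone]
  unfold weight
  rw [hsum, hcard, Sa, Sb, Sc, Sd, Se]
  simp only [Va, Vb, Vc, Vd, Ve]
  clear * -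
  by_cases h1 : s(a, b) ∈ IE P X <;> by_cases h2 : s(b, c) ∈ IE P X <;>
    by_cases h3 : s(c, d) ∈ IE P X <;> by_cases h4 : s(d, e) ∈ IE P X <;>
    by_cases h5 : s(e, a) ∈ IE P X <;> simp [h1, h2, h3, h4, h5]

lemma counting {P : PlaneGraph V} (hP : IsFullerene P) {X : Finset (Finset (Sym2 V))}
    (hX : X ⊆ P.faces) (h5 : ∀ p ∈ X, p.card = 5) (hchi : 1 ≤ chi P X) (q : Finset (Sym2 V))
    (hq : q ∈ X → 1 ≤ (q ∩ IE P X).card)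
    (hp : ∀ p ∈ X, p ≠ q → 3 ≤ (p ∩ IE P X).card ∨
      ((p ∩ IE P X).card = 2 ∧ ∀ v ∈ edgeVerts p, v ∉ IV P X)) :
    ∃ p ∈ X, ∀ e ∈ p, e ∈ IE P X := by
  by_contra hcon
  have hcon' : ∀ p ∈ X, ¬ ∀ e ∈ p, e ∈ IE P X := fun p hp h => hcon ⟨p, hp, h⟩
  have h1 := weight_sum hP hX
  have h2 : ∀ p ∈ X, weight P X p ≤ if p = q then 2 else 0 := by
    intro p hpX
    have := (weight_pent hP (hX hpX) (h5 p hpX)).resolve_left (hcon' p hpX)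
    split_ifs with h
    · subst h; exact this.1 (hq hpX)
    · rcases hp p hpX h with h' | h'
      · exact this.2.1 h'
      · exact this.2.2 h'.1 h'.2
  have h3 := Finset.sum_le_sum h2
  rw [Finset.sum_ite_eq'] at h3
  split_ifs at h3 <;> omega

/-! ### The main argument -/

lemma adj_le {P : PlaneGraph V} {X A : Finset (Finset (Sym2 V))} {p : Finset (Sym2 V)}
    (hX : X ⊆ P.faces) (hp : p ∈ X) (hA : A ⊆ X) (h : ∀ q ∈ A, q ≠ p ∧ (q ∩ p).Nonempty) :
    A.card ≤ (p ∩ IE P X).card := by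
  obtain ⟨e0, he0⟩ := (P.fc (hX hp)).nonempty
  have hch : ∀ q, ∃ e, q ∈ A → e ∈ q ∧ e ∈ p := by
    intro q
    by_cases hq : q ∈ A
    · obtain ⟨e, he⟩ := (h q hq).2
      rw [Finset.mem_inter] at he
      exact ⟨e, fun _ => he⟩
    · exact ⟨e0, fun h => absurd h hq⟩
  choose e he using hch
  apply Finset.card_le_card_of_injOn e
  · intro q hq
    rw [Finset.mem_coe] at hq
    rw [Finset.mem_coe, Finset.mem_inter]
    exact ⟨(he q hq).2, IE_of_share hX (hA hq) hp (h q hq).1 (he q hq).1 (he q hq).2⟩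
  · intro q hq q' hq' hqq
    rw [Finset.mem_coe] at hq hq'
    have h1 := he q' hq'
    rw [← hqq] at h1
    rcases only_two P (hX (hA hq)) (hX hp) (h q hq).1 (he q hq).1 (he q hq).2 (hX (hA hq')) h1.1
      with h' | h'
    · exact h'.symm
    · exact absurd h' (h q' hq').1

lemma interior_ring {P : PlaneGraph V} (hP : IsFullerene P) {X : Finset (Finset (Sym2 V))}
    (hX : X ⊆ P.faces) (h5 : ∀ p ∈ X, p.card = 5) {p : Finset (Sym2 V)} (hp : p ∈ X)
    (hi : ∀ e ∈ p, e ∈ IE P X) :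
    ∃ R : ZMod 5 → Finset (Sym2 V), IsPentRing P 5 R ∧ ∀ i, R i ∈ X ∧ R i ≠ p := by
  have hin : ∀ q ∈ P.faces, (q ∩ p).Nonempty → q ∈ X := by
    rintro q hq ⟨e, he⟩
    rw [Finset.mem_inter] at he
    exact (mem_IE.1 (hi e he.2)).2 q hq he.1
  obtain ⟨R, hR, h⟩ := ring_of hP (hX hp) (h5 p hp) fun q hq _ hqp => h5 q (hin q hq hqp)
  exact ⟨R, hR, fun i => ⟨hin _ (h i).1 (h i).2.2, (h i).2.1⟩⟩

lemma interior_card {P : PlaneGraph V} (hP : IsFullerene P) {X : Finset (Finset (Sym2 V))}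
    (hX : X ⊆ P.faces) (h5 : ∀ p ∈ X, p.card = 5) {p : Finset (Sym2 V)} (hp : p ∈ X)
    (hi : ∀ e ∈ p, e ∈ IE P X) : 6 ≤ X.card := by
  obtain ⟨R, hR, h⟩ := interior_ring hP hX h5 hp hi
  have h1 : (Finset.univ.image R).card = 5 := by
    rw [Finset.card_image_of_injective _ hR.1, Finset.card_univ, ZMod.card]
  have h2 : p ∉ Finset.univ.image R := by
    intro hm
    obtain ⟨i, -, hi⟩ := Finset.mem_image.1 hm
    exact (h i).2 hi
  have h3 : insert p (Finset.univ.image R) ⊆ X := by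
    intro f hf
    rcases Finset.mem_insert.1 hf with rfl | hf
    · exact hp
    · obtain ⟨i, -, rfl⟩ := Finset.mem_image.1 hf
      exact (h i).1
  have := Finset.card_le_card h3
  rw [Finset.card_insert_of_notMem h2, h1] at this
  exact this

lemma IV_mono {P : PlaneGraph V} {X Y : Finset (Finset (Sym2 V))} (h : X ⊆ Y) :
    IV P X ⊆ IV P Y := fun _ hv => mem_IV.2 fun f hf hvf => h (mem_IV.1 hv f hf hvf)

lemma IE_mono {P : PlaneGraph V} {X Y : Finset (Finset (Sym2 V))} (h : X ⊆ Y) :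
    IE P X ⊆ IE P Y := fun _ he => mem_IE.2 ⟨(mem_IE.1 he).1,
      fun f hf hef => h ((mem_IE.1 he).2 f hf hef)⟩

lemma chi_add {P : PlaneGraph V} (hP : IsFullerene P) {X Y : Finset (Finset (Sym2 V))}
    (hX : X ⊆ P.faces) (hXY : ∀ f ∈ X, ∀ g ∈ Y, ¬ (f ∩ g).Nonempty) :
    chi P (X ∪ Y) = chi P X + chi P Y := by
  have hd : ∀ f ∈ X, f ∉ Y := by
    intro f hf hfY
    apply hXY f hf f hfY
    rw [Finset.inter_self]
    exact (P.fc (hX hf)).nonempty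
  have h1 : (X ∪ Y).card = X.card + Y.card :=
    Finset.card_union_of_disjoint (Finset.disjoint_left.2 hd)
  have h2 : (IE P (X ∪ Y)).card = (IE P X).card + (IE P Y).card := by
    rw [← Finset.card_union_of_disjoint]
    · congr 1
      apply Finset.Subset.antisymm
      · intro e he
        obtain ⟨hE, he⟩ := mem_IE.1 he
        obtain ⟨f, g, -, hf, hg, hef, heg, hall⟩ := edge_two P hE
        have hfg : (f ∩ g).Nonempty := ⟨e, Finset.mem_inter.2 ⟨hef, heg⟩⟩
        have hgf : (g ∩ f).Nonempty := ⟨e, Finset.mem_inter.2 ⟨heg, hef⟩⟩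
        have h1 := Finset.mem_union.1 (he f hf hef)
        have h2 := Finset.mem_union.1 (he g hg heg)
        rw [Finset.mem_union, mem_IE, mem_IE]
        rcases h1 with h1 | h1 <;> rcases h2 with h2 | h2
        · left
          refine ⟨hE, fun k hk hek => ?_⟩
          rcases hall k hk hek with rfl | rfl <;> assumption
        · exact absurd hfg (hXY _ h1 _ h2)
        · exact absurd hgf (hXY _ h2 _ h1)
        · right
          refine ⟨hE, fun k hk hek => ?_⟩
          rcases hall k hk hek with rfl | rfl <;> assumption
      · exact Finset.union_subset (IE_mono Finset.subset_union_left)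
          (IE_mono Finset.subset_union_right)
    · rw [Finset.disjoint_left]
      intro e h1 h2
      rw [mem_IE] at h1 h2
      obtain ⟨f, g, -, hf, hg, hef, heg, hall⟩ := edge_two P h1.1
      exact hd f (h1.2 f hf hef) (h2.2 f hf hef)
  have h3 : (IV P (X ∪ Y)).card = (IV P X).card + (IV P Y).card := by
    rw [← Finset.card_union_of_disjoint]
    · congr 1
      apply Finset.Subset.antisymm
      · intro v hv
        rw [mem_IV] at hv
        rw [Finset.mem_union]
        by_contra hcon
        rw [not_or, mem_IV, mem_IV] at hcon
        push Not at hcon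
        obtain ⟨⟨f, hf, hvf, hfX⟩, g, hg, hvg, hgY⟩ := hcon
        have hfY := (Finset.mem_union.1 (hv f hf hvf)).resolve_left hfX
        have hgX := (Finset.mem_union.1 (hv g hg hvg)).resolve_right hgY
        obtain ⟨x, hx1, hx2⟩ := share_edge hP hg hf hvg hvf
        exact hXY g hgX f hfY ⟨_, Finset.mem_inter.2 ⟨hx1, hx2⟩⟩
      · exact Finset.union_subset (IV_mono Finset.subset_union_left)
          (IV_mono Finset.subset_union_right)
    · rw [Finset.disjoint_left]
      intro v h1 h2
      rw [mem_IV] at h1 h2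
      obtain ⟨a, b, c, f, g, h, -, -, -, -, hf, -, -, -, -, -, -, -, -, hv⟩ := vert_struct hP v
      have hvf := (hv f hf).2 (Or.inl rfl)
      exact hd f (h1 f hf hvf) (h2 f hf hvf)
  unfold chi
  rw [h1, h2, h3]
  push_cast
  ring

lemma good_of_IV {P : PlaneGraph V} (hP : IsFullerene P) (B : Fragment P) {p : Finset (Sym2 V)}
    (hp : p ∈ B.inFaces) (h2 : pentAdjCount B p = 2) {v : V} (hv : v ∈ edgeVerts p)
    (hvI : v ∈ IV P B.inFaces) :
    ∃ p₁ p₂ : Finset (Sym2 V), p₁ ≠ p₂ ∧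
      B.inFaces.filter (fun q => q ≠ p ∧ (q ∩ p).Nonempty) = {p₁, p₂} ∧ (p₁ ∩ p₂).Nonempty := by
  have hpf := B.subFaces hp
  obtain ⟨x, hx⟩ := mem_edgeVerts.1 hv
  obtain ⟨y, hyx, hy⟩ := face_next P hpf hx
  obtain ⟨z, hzx, hzy, hN⟩ := third hP (P.adj hpf hx) (P.adj hpf hy) hyx.symm
  have hz : P.graph.Adj v z := (hN z).2 (by simp)
  have hzp : s(v, z) ∉ p := fun h => by
    rcases no_three P hpf hx hy h hyx.symm with h | h <;> contradiction
  obtain ⟨q1, hq1, q1x, q1z⟩ := pair_face hP (P.adj hpf hx) hz hzx.symm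
  obtain ⟨q2, hq2, q2y, q2z⟩ := pair_face hP (P.adj hpf hy) hz hzy.symm
  have n1 : q1 ≠ p := fun h => hzp (h ▸ q1z)
  have n2 : q2 ≠ p := fun h => hzp (h ▸ q2z)
  have n12 : q1 ≠ q2 := by
    rintro rfl
    rcases no_three P hq1 q1x q2y q1z hyx.symm with h | h <;> contradiction
  have b1 : q1 ∈ B.inFaces := mem_IV.1 hvI q1 hq1 (mem_edgeVerts.2 ⟨_, q1x⟩)
  have b2 : q2 ∈ B.inFaces := mem_IV.1 hvI q2 hq2 (mem_edgeVerts.2 ⟨_, q2y⟩)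
  refine ⟨q1, q2, n12, ?_, ⟨_, Finset.mem_inter.2 ⟨q1z, q2z⟩⟩⟩
  symm
  apply Finset.eq_of_subset_of_card_le
  · intro q hq
    rw [Finset.mem_filter]
    rcases Finset.mem_insert.1 hq with rfl | hq
    · exact ⟨b1, n1, _, Finset.mem_inter.2 ⟨q1x, hx⟩⟩
    · rw [Finset.mem_singleton] at hq
      subst hq
      exact ⟨b2, n2, _, Finset.mem_inter.2 ⟨q2y, hy⟩⟩
  · rw [Finset.card_pair n12]
    exact h2.le

lemma half {P : PlaneGraph V} (hP : IsFullerene P) (B : Fragment P)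
    (hB : IsPentagonalFragment B) (h2 : ∀ p ∈ B.inFaces, 2 ≤ pentAdjCount B p)
    (hgood : ∀ p ∈ B.inFaces, pentAdjCount B p = 2 → ∀ v ∈ edgeVerts p, v ∉ IV P B.inFaces)
    {p : Finset (Sym2 V)} {Z : Finset (Finset (Sym2 V))}
    (hZ : Z ⊆ B.inFaces.erase p)
    (hcl : ∀ f ∈ Z, ∀ g ∈ B.inFaces.erase p, (f ∩ g).Nonempty → g ∈ Z) (hchi : 1 ≤ chi P Z)
    (q : Finset (Sym2 V)) (hq : ∀ f ∈ Z, f ≠ q → ¬ (p ∩ f).Nonempty) : 6 ≤ Z.card := by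
  have hZB : Z ⊆ B.inFaces := hZ.trans (Finset.erase_subset _ _)
  have hZF : Z ⊆ P.faces := hZB.trans B.subFaces
  have hin : ∀ f ∈ Z, ∀ g ∈ B.inFaces, g ≠ p → (g ∩ f).Nonempty → g ∈ Z := by
    intro f hf g hg hgp hgf
    refine hcl f hf g (Finset.mem_erase.2 ⟨hgp, hg⟩) ?_
    rwa [Finset.inter_comm]
  obtain ⟨r, hr, hri⟩ := counting hP hZF (fun f hf => hB f (hZB hf)) hchi q (by
      intro hqZ
      have hc := h2 q (hZB hqZ)
      unfold pentAdjCount at hc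
      have h1 := Finset.pred_card_le_card_erase (a := p)
        (s := B.inFaces.filter fun k => k ≠ q ∧ (k ∩ q).Nonempty)
      have h3 := adj_le (A := (B.inFaces.filter fun k => k ≠ q ∧ (k ∩ q).Nonempty).erase p)
        hZF hqZ (by
          intro k hk
          rw [Finset.mem_erase, Finset.mem_filter] at hk
          exact hin q hqZ k hk.2.1 hk.1 hk.2.2.2) (by
          intro k hk
          rw [Finset.mem_erase, Finset.mem_filter] at hk
          exact hk.2.2)
      omega) (by
      intro f hf hfq
      have hc := h2 f (hZB hf)
      have h3 := adj_le (A := B.inFaces.filter fun k => k ≠ f ∧ (k ∩ f).Nonempty) hZF hf (by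
          intro k hk
          rw [Finset.mem_filter] at hk
          refine hin f hf k hk.1 ?_ hk.2.2
          rintro rfl
          exact hq f hf hfq hk.2.2) (by
          intro k hk
          rw [Finset.mem_filter] at hk
          exact hk.2)
      change pentAdjCount B f ≤ _ at h3
      by_cases h4 : 3 ≤ (f ∩ IE P Z).card
      · exact Or.inl h4
      · right
        refine ⟨by omega, fun v hv hvI => ?_⟩
        exact hgood f (hZB hf) (by omega) v hv (IV_mono hZB hvI))
  exact interior_card hP hZF (fun f hf => hB f (hZB hf)) hr hri

lemma part_two {P : PlaneGraph V} (hP : IsFullerene P) (B : Fragment P)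
    (hB : IsPentagonalFragment B) (h2 : ∀ p ∈ B.inFaces, 2 ≤ pentAdjCount B p)
    (hgood : ∀ p ∈ B.inFaces, pentAdjCount B p = 2 → ∀ v ∈ edgeVerts p, v ∉ IV P B.inFaces)
    {p : Finset (Sym2 V)} (hp : p ∈ B.inFaces) (hp2 : pentAdjCount B p = 2) : False := by
  have hconn := frag_conn hP B
  have hchi := frag_chi hP B
  obtain ⟨p₁, p₂, h12, hpp⟩ := Finset.card_eq_two.1 hp2
  have hm : ∀ k, (k ∈ B.inFaces ∧ k ≠ p ∧ (k ∩ p).Nonempty) ↔ k = p₁ ∨ k = p₂ := by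
    intro k
    have : k ∈ B.inFaces.filter (fun q => q ≠ p ∧ (q ∩ p).Nonempty) ↔ k = p₁ ∨ k = p₂ := by
      rw [hpp]; simp
    rwa [Finset.mem_filter] at this
  obtain ⟨b1, n1, e1, he1⟩ := (hm p₁).2 (Or.inl rfl)
  obtain ⟨b2, n2, e2, he2⟩ := (hm p₂).2 (Or.inr rfl)
  rw [Finset.mem_inter] at he1 he2
  obtain ⟨Y, hY⟩ : ∃ Y, Y = B.inFaces.erase p := ⟨_, rfl⟩
  have hYB : Y ⊆ B.inFaces := hY ▸ Finset.erase_subset _ _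
  have hYF : Y ⊆ P.faces := hYB.trans B.subFaces
  have hYm : ∀ f, f ∈ Y ↔ f ≠ p ∧ f ∈ B.inFaces := fun f => by rw [hY, Finset.mem_erase]
  have hYc : Y.card + 1 = B.inFaces.card := by rw [hY]; exact Finset.card_erase_add_one hp
  have he12 : e1 ≠ e2 := by
    rintro rfl
    rcases only_two P (B.subFaces b1) (B.subFaces hp) n1 he1.1 he1.2 (B.subFaces b2) he2.1
      with h | h
    · exact h12 h.symm
    · exact n2 h
  have hchiY : 2 ≤ chi P Y := by
    have hIV : IV P Y = IV P B.inFaces := by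
      apply Finset.Subset.antisymm (IV_mono hYB)
      intro v hv
      refine mem_IV.2 fun f hf hvf => (hYm f).2 ⟨?_, mem_IV.1 hv f hf hvf⟩
      rintro rfl
      exact hgood f hp hp2 v hvf hv
    have hIE : (IE P Y).card + 2 ≤ (IE P B.inFaces).card := by
      have hdis : Disjoint (IE P Y) {e1, e2} := by
        rw [Finset.disjoint_left]
        intro e he hee
        have hep : e ∈ p := by
          rcases Finset.mem_insert.1 hee with rfl | h
          · exact he1.2
          · rw [Finset.mem_singleton] at h; subst h; exact he2.2
        have := (mem_IE.1 he).2 p (B.subFaces hp) hep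
        exact ((hYm p).1 this).1 rfl
      rw [← Finset.card_pair he12, ← Finset.card_union_of_disjoint hdis]
      apply Finset.card_le_card
      apply Finset.union_subset (IE_mono hYB)
      intro e hee
      rcases Finset.mem_insert.1 hee with rfl | h
      · exact IE_of_share B.subFaces b1 hp n1 he1.1 he1.2
      · rw [Finset.mem_singleton] at h; subst h
        exact IE_of_share B.subFaces b2 hp n2 he2.1 he2.2
    unfold chi at hchi ⊢
    rw [hIV]
    omega
  -- closed subsets of `Y`
  let Cl : Finset (Finset (Sym2 V)) → Prop := fun S =>
    S ⊆ Y ∧ ∀ f ∈ S, ∀ g ∈ Y, (f ∩ g).Nonempty → g ∈ S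
  have hhit : ∀ S, Cl S → S.Nonempty → p₁ ∈ S ∨ p₂ ∈ S := by
    rintro S ⟨hS, hcl⟩ hne
    by_contra hcon
    rw [not_or] at hcon
    have := hconn S (hS.trans hYB) hne (by
      intro f hf g hg hfg
      by_cases hgp : g = p
      · subst hgp
        rcases (hm f).1 ⟨hYB (hS hf), ((hYm f).1 (hS hf)).1, hfg⟩ with rfl | rfl
        · exact absurd hf hcon.1
        · exact absurd hf hcon.2
      · exact hcl f hf g ((hYm g).2 ⟨hgp, hg⟩) hfg)
    rw [← this] at hp
    exact ((hYm p).1 (hS hp)).1 rfl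
  have hdiff : ∀ S T, Cl S → Cl T → Cl (T \ S) := by
    rintro S T ⟨hS, hcS⟩ ⟨hT, hcT⟩
    refine ⟨Finset.sdiff_subset.trans hT, fun f hf g hg hfg => ?_⟩
    rw [Finset.mem_sdiff] at hf ⊢
    refine ⟨hcT f hf.1 g hg hfg, fun hgS => hf.2 (hcS g hgS f (hT hf.1) ?_)⟩
    rwa [Finset.inter_comm]
  have hne : ∀ Z ⊆ Y, Z ≠ P.faces := fun Z hZ h => by
    have h1 : p ∈ Z := by rw [h]; exact B.subFaces hp
    exact ((hYm p).1 (hZ h1)).1 rfl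
  have hnc : ¬ Conn Y := fun h => by
    have := conn_chi hP hYF (hne Y (Finset.Subset.refl _)) h
    omega
  have hSex : ∃ S, Cl S ∧ S.Nonempty ∧ S ≠ Y := by
    by_contra hcon
    apply hnc
    intro S hS hSne hcl
    by_contra hSY
    exact hcon ⟨S, ⟨hS, hcl⟩, hSne, hSY⟩
  obtain ⟨S, hS, hSne, hSY⟩ := hSex
  have hYcl : Cl Y := ⟨Finset.Subset.refl _, fun f _ g hg _ => hg⟩
  have hT := hdiff S Y hS hYcl
  have hTne : (Y \ S).Nonempty := by
    rw [Finset.sdiff_nonempty]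
    exact fun h => hSY (Finset.Subset.antisymm hS.1 h)
  have hsum : chi P Y = chi P S + chi P (Y \ S) := by
    rw [← chi_add hP (hS.1.trans hYF), Finset.union_sdiff_of_subset hS.1]
    intro f hf g hg hfg
    rw [Finset.mem_sdiff] at hg
    exact hg.2 (hS.2 f hf g hg.1 hfg)
  -- a closed set with nonempty closed complement is connected
  have hcc : ∀ Z W, Cl Z → Cl W → Disjoint Z W → W.Nonempty → chi P Z ≤ 1 := by
    intro Z W hZ hW hd hWne
    refine conn_chi hP (hZ.1.trans hYF) (hne Z hZ.1) ?_
    intro A hA hAne hcl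
    by_contra hAZ
    have hA' : Cl A := ⟨hA.trans hZ.1, fun f hf g hg hfg =>
      hcl f hf g (hZ.2 f (hA hf) g hg hfg) hfg⟩
    have hB' := hdiff A Z hA' hZ
    have hBne : (Z \ A).Nonempty := by
      rw [Finset.sdiff_nonempty]
      exact fun h => hAZ (Finset.Subset.antisymm hA h)
    have c1 := hhit A hA' hAne
    have c2 := hhit _ hB' hBne
    have c3 := hhit W hW hWne
    rw [Finset.mem_sdiff, Finset.mem_sdiff] at c2
    have d1 : p₁ ∈ Z → p₁ ∉ W := fun h => Finset.disjoint_left.1 hd h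
    have d2 : p₂ ∈ Z → p₂ ∉ W := fun h => Finset.disjoint_left.1 hd h
    have e1 : p₁ ∈ A → p₁ ∈ Z := fun h => hA h
    have e2 : p₂ ∈ A → p₂ ∈ Z := fun h => hA h
    clear * - c1 c2 c3 d1 d2 e1 e2
    tauto
  have hsix : ∀ Z W, Cl Z → Cl W → Disjoint Z W → W.Nonempty → 1 ≤ chi P Z → 6 ≤ Z.card := by
    intro Z W hZ hW hd hWne hcZ
    obtain ⟨q, hq⟩ : ∃ q, ∀ f ∈ Z, f ≠ q → f ≠ p₁ ∧ f ≠ p₂ := by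
      rcases hhit W hW hWne with h | h
      · refine ⟨p₂, fun f hf hfq => ⟨?_, hfq⟩⟩
        rintro rfl
        exact Finset.disjoint_left.1 hd hf h
      · refine ⟨p₁, fun f hf hfq => ⟨hfq, ?_⟩⟩
        rintro rfl
        exact Finset.disjoint_left.1 hd hf h
    refine half hP B hB h2 hgood (p := p) (hY ▸ hZ.1) (hY ▸ hZ.2) hcZ q ?_
    intro f hf hfq hpf
    rw [Finset.inter_comm] at hpf
    have hfY := (hYm f).1 (hZ.1 hf)
    rcases (hm f).1 ⟨hfY.2, hfY.1, hpf⟩ with h | h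
    · exact (hq f hf hfq).1 h
    · exact (hq f hf hfq).2 h
  have hdis : Disjoint S (Y \ S) := Finset.disjoint_sdiff
  have k1 := hcc S _ hS hT hdis hTne
  have k2 := hcc _ S hT hS hdis.symm hSne
  have k3 := hsix S _ hS hT hdis hTne (by omega)
  have k4 := hsix _ S hT hS hdis.symm hSne (by omega)
  have k5 : (Y \ S).card + S.card = Y.card := Finset.card_sdiff_add_card_eq_card hS.1
  have k6 : B.inFaces.card ≤ 12 := by
    rw [← hP.pentTwelve]
    apply Finset.card_le_card
    intro f hf
    exact Finset.mem_filter.2 ⟨B.subFaces hf, hB f hf⟩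
  omega

/-- Lemma 3.6. Let `B` be a pentagonal fragment of a fullerene graph.
(1) If `γ(B) ≥ 3` then `R_5 ⊆ B`; (2) if `γ(B) = 2` then `B` has a pentagon adjoining
exactly two pentagons of `B`, and these two pentagons are adjacent to each other. -/
theorem statement_9 (P : PlaneGraph V) (hP : IsFullerene P) (B : Fragment P)
    (hB : IsPentagonalFragment B) :
    ((∀ p ∈ B.inFaces, 3 ≤ pentAdjCount B p) →
      ∃ R : ZMod 5 → Finset (Sym2 V), IsPentRing P 5 R ∧ ∀ i, R i ∈ B.inFaces) ∧
    (((∀ p ∈ B.inFaces, 2 ≤ pentAdjCount B p) ∧ (∃ p ∈ B.inFaces, pentAdjCount B p = 2)) →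
      ∃ p ∈ B.inFaces, ∃ p₁ p₂ : Finset (Sym2 V), p₁ ≠ p₂ ∧
        B.inFaces.filter (fun q => q ≠ p ∧ (q ∩ p).Nonempty) = {p₁, p₂} ∧
        (p₁ ∩ p₂).Nonempty) := by
  constructor
  · intro h3
    obtain ⟨p, hp, hpi⟩ := counting hP B.subFaces hB (frag_chi hP B) ∅ (by
        intro h
        have := hB _ h
        simp at this) (by
        intro p hp _
        left
        refine (h3 p hp).trans (adj_le B.subFaces hp (Finset.filter_subset _ _) ?_)
        intro q hq
        exact (Finset.mem_filter.1 hq).2)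
    obtain ⟨R, hR, h⟩ := interior_ring hP B.subFaces hB hp hpi
    exact ⟨R, hR, fun i => (h i).1⟩
  · rintro ⟨h2, p, hp, hp2⟩
    by_contra hcon
    refine part_two hP B hB h2 ?_ hp hp2
    intro r hr hr2 v hv hvI
    exact hcon ⟨r, hr, good_of_IV hP B hr hr2 hv hvI⟩

end FG
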